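/- arXiv:1309.2776 — 2 statements merged into one kernel-verified Lean document; each statement's English description precedes it below -/
import Mathlib

section
/- Let S = K[x_1,...,x_n] over a field K, and let M be an ideal of S generated by products of linear forms (a totally reducible ideal) that contains a homogeneous regular sequence f_1,...,f_t with deg(f_i) = a_i and a_1 ≤ ... ≤ a_t. If I is a graded ideal of S of height t containing M such that S/I is Cohen–Macaulay, then there exists a graded ideal J of S containing x_1^{a_1},...,x_t^{a_t} such that S/J is Cohen–Macaulay and dim_K (S/J)_d = dim_K (S/I)_d for all d ≥ 0. -/
set_option synthInstance.maxHeartbeats 1000000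
set_option maxHeartbeats 1000000

open MvPolynomial

/-- `dim_K (S/I)_d`, the Hilbert function of `S/I` in degree `d`:
the `K`-dimension of `S_d / I_d`. -/
noncomputable def hilbertFn {n : ℕ} (K : Type*) [Field K]
    (I : Ideal (MvPolynomial (Fin n) K)) (d : ℕ) : ℕ :=
  Module.finrank K
    (↥(homogeneousSubmodule (Fin n) K d) ⧸
      (Submodule.comap (homogeneousSubmodule (Fin n) K d).subtype
        (Submodule.restrictScalars K I)))

/-- A graded (homogeneous) ideal of `S = K[x₁,…,xₙ]`. -/
def IsGradedIdeal {n : ℕ} {K : Type*} [Field K] (I : Ideal (MvPolynomial (Fin n) K)) : Prop :=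
  ∀ f ∈ I, ∀ d : ℕ, homogeneousComponent d f ∈ I

/-- An ideal of `S = K[x₁,…,xₙ]` is totally reducible if it is generated by
products of linear forms. -/
def TotallyReducible {n : ℕ} {K : Type*} [Field K] (I : Ideal (MvPolynomial (Fin n) K)) : Prop :=
  ∃ G : Set (MvPolynomial (Fin n) K), I = Ideal.span G ∧
    ∀ g ∈ G, ∃ (k : ℕ) (ℓ : Fin k → MvPolynomial (Fin n) K),
      (∀ i, (ℓ i).IsHomogeneous 1) ∧ g = ∏ i, ℓ i

/-- The height of an ideal: the infimum of the heights (in the prime spectrum)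
of the primes containing it. -/
noncomputable def idealHeight {R : Type*} [CommRing R] (I : Ideal R) : ℕ∞ :=
  sInf {h : ℕ∞ | ∃ p : PrimeSpectrum R, I ≤ p.asIdeal ∧ h = Order.height p}

/-- `S/I` is Cohen–Macaulay: there is a regular sequence on `S/I` consisting of elements
of the (irrelevant) maximal ideal `(x₁,…,xₙ)` of `S/I` whose length equals the Krull
dimension of `S/I` (depth = Krull dimension). -/
def QuotientIsCM {n : ℕ} {K : Type*} [Field K] (I : Ideal (MvPolynomial (Fin n) K)) : Prop :=
  ∃ rs : List (MvPolynomial (Fin n) K ⧸ I),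
    (∀ x ∈ rs, x ∈ Ideal.map (Ideal.Quotient.mk I)
        (Ideal.span (Set.range (X : Fin n → MvPolynomial (Fin n) K)))) ∧
    RingTheory.Sequence.IsRegular (MvPolynomial (Fin n) K ⧸ I) rs ∧
    (rs.length : WithBot ℕ∞) = ringKrullDim (MvPolynomial (Fin n) K ⧸ I)

namespace EGH
open Finset

/-- box -/
def Bx {n : ℕ} (a : Fin n → ℕ) (d : ℕ) : Finset (Fin n → ℕ) :=
  (Fintype.piFinset fun i => Finset.range (a i)).filter (fun w => ∑ i, w i = d)

theorem mem_Bx {n : ℕ} {a : Fin n → ℕ} {d : ℕ} {w : Fin n → ℕ} :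
    w ∈ Bx a d ↔ (∀ i, w i < a i) ∧ ∑ i, w i = d := by
  simp [Bx]

/-- lex -/
def LLt {n : ℕ} (u w : Fin n → ℕ) : Prop := ∃ i, (∀ j < i, u j = w j) ∧ u i < w i

theorem LLt_iff {n : ℕ} {u w : Fin n → ℕ} : LLt u w ↔ toLex u < toLex w := Iff.rfl

theorem LLt.tri {n : ℕ} (u w : Fin n → ℕ) : LLt u w ∨ u = w ∨ LLt w u := by
  simp only [LLt_iff]
  rcases lt_trichotomy (toLex u) (toLex w) with h | h | h
  · exact Or.inl h
  · exact Or.inr (Or.inl (toLex.injective h))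
  · exact Or.inr (Or.inr h)

theorem LLt.trans {n : ℕ} {u v w : Fin n → ℕ} (h : LLt u v) (h' : LLt v w) : LLt u w := by
  rw [LLt_iff] at *; exact lt_trans h h'

theorem LLt.irrefl {n : ℕ} {u : Fin n → ℕ} (h : LLt u u) : False := by
  rw [LLt_iff] at *; exact lt_irrefl _ h

/-- segment -/
def IsSeg {n : ℕ} (a : Fin n → ℕ) (d : ℕ) (A : Finset (Fin n → ℕ)) : Prop :=
  A ⊆ Bx a d ∧ ∀ u ∈ A, ∀ w ∈ Bx a d, LLt u w → w ∈ A

open Classical in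
/-- shadow -/
noncomputable def Sh {n : ℕ} (a : Fin n → ℕ) (d : ℕ) (A : Finset (Fin n → ℕ)) :
    Finset (Fin n → ℕ) := (Bx a (d+1)).filter (fun v => ∃ u ∈ A, u ≤ v)

theorem mem_Sh {n : ℕ} {a : Fin n → ℕ} {d : ℕ} {A : Finset (Fin n → ℕ)} {v : Fin n → ℕ} :
    v ∈ Sh a d A ↔ v ∈ Bx a (d+1) ∧ ∃ u ∈ A, u ≤ v := by
  simp [Sh]

theorem Sh_mono {n : ℕ} {a : Fin n → ℕ} {d : ℕ} {A B : Finset (Fin n → ℕ)} (h : A ⊆ B) :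
    Sh a d A ⊆ Sh a d B := by
  intro v hv
  rw [mem_Sh] at *
  obtain ⟨h1, u, hu, h2⟩ := hv
  exact ⟨h1, u, h hu, h2⟩

theorem seg_exists {n : ℕ} (a : Fin n → ℕ) (d q : ℕ) (hq : q ≤ (Bx a d).card) :
    ∃ A, IsSeg a d A ∧ A.card = q := by
  classical
  induction q with
  | zero => exact ⟨∅, ⟨by simp, by simp⟩, by simp⟩
  | succ q ih =>
    obtain ⟨A, hA, hc⟩ := ih (by omega)
    have hne : (Bx a d \ A).Nonempty := by
      rw [← Finset.card_pos, Finset.card_sdiff_of_subset hA.1]; omega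
    obtain ⟨x, hx, hmax⟩ := Finset.exists_max_image (Bx a d \ A) (fun w => toLex w) hne
    rw [Finset.mem_sdiff] at hx
    refine ⟨insert x A, ⟨?_, ?_⟩, ?_⟩
    · intro y hy
      rcases Finset.mem_insert.1 hy with rfl | h
      · exact hx.1
      · exact hA.1 h
    · intro u hu w hw huw
      rcases Finset.mem_insert.1 hu with rfl | h
      · by_contra hn
        have : w ∈ Bx a d \ A := by
          rw [Finset.mem_sdiff]; exact ⟨hw, fun h => hn (Finset.mem_insert_of_mem h)⟩
        exact absurd (hmax w this) (not_le.2 (LLt_iff.1 huw))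
      · exact Finset.mem_insert_of_mem (hA.2 u h w hw huw)
    · rw [Finset.card_insert_of_notMem hx.2, hc]

theorem seg_subset {n : ℕ} {a : Fin n → ℕ} {d : ℕ} {A B : Finset (Fin n → ℕ)}
    (hA : IsSeg a d A) (hB : IsSeg a d B) (h : A.card ≤ B.card) : A ⊆ B := by
  by_contra hn
  obtain ⟨x, hxA, hxB⟩ := Finset.not_subset.1 hn
  have : B ⊆ A := by
    intro y hy
    rcases LLt.tri x y with h | h | h
    · exact hA.2 x hxA y (hB.1 hy) h
    · exact h ▸ hxA
    · exact absurd (hB.2 y hy x (hA.1 hxA) h) hxB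
  have := Finset.eq_of_subset_of_card_le this h
  exact hxB (this ▸ hxA)

theorem sum_update {n : ℕ} (w : Fin n → ℕ) (s : Fin n) (x : ℕ) :
    ∑ i, Function.update w s x i + w s = ∑ i, w i + x := by
  rw [Finset.sum_update_of_mem (Finset.mem_univ s), ← Finset.add_sum_erase _ w (Finset.mem_univ s),
    Finset.sdiff_singleton_eq_erase]
  ring

theorem not_le_of_sum {n : ℕ} {u v : Fin n → ℕ} (h : ∑ i, u i = ∑ i, v i) (hle : u ≤ v) : u = v := by
  by_contra hn
  have hex : ∃ i, u i ≠ v i := by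
    by_contra! h'; exact hn (funext h')
  obtain ⟨i, hi⟩ := hex
  have := Finset.sum_lt_sum (s := Finset.univ) (fun i _ => hle i) ⟨i, Finset.mem_univ _, lt_of_le_of_ne (hle i) hi⟩
  omega

theorem dec_mem {n : ℕ} {a : Fin n → ℕ} {d : ℕ} {v : Fin n → ℕ} (hv : v ∈ Bx a (d+1)) (s : Fin n)
    (hs : 0 < v s) : Function.update v s (v s - 1) ∈ Bx a d := by
  rw [mem_Bx] at *
  refine ⟨fun i => ?_, ?_⟩
  · by_cases h : i = s
    · subst h; simp; have := hv.1 i; omega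
    · simp [h]; exact hv.1 i
  · have := sum_update v s (v s - 1); omega

theorem dec_le {n : ℕ} (v : Fin n → ℕ) (s : Fin n) : Function.update v s (v s - 1) ≤ v := by
  intro i
  by_cases h : i = s
  · subst h; simp
  · simp [h]

theorem inc_mem {n : ℕ} {a : Fin n → ℕ} {d : ℕ} {v : Fin n → ℕ} (hv : v ∈ Bx a d) (s : Fin n)
    (hs : v s + 1 < a s) : Function.update v s (v s + 1) ∈ Bx a (d+1) := by
  rw [mem_Bx] at *
  refine ⟨fun i => ?_, ?_⟩
  · by_cases h : i = s
    · subst h; simp; omega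
    · simp [h]; exact hv.1 i
  · have := sum_update v s (v s + 1); omega

theorem inc_le {n : ℕ} (v : Fin n → ℕ) (s : Fin n) : v ≤ Function.update v s (v s + 1) := by
  intro i
  by_cases h : i = s
  · subst h; simp
  · simp [h]

theorem Sh_seg {n : ℕ} {a : Fin n → ℕ} {d : ℕ} {A : Finset (Fin n → ℕ)} (hA : IsSeg a d A) :
    IsSeg a (d+1) (Sh a d A) := by
  refine ⟨fun v hv => (mem_Sh.1 hv).1, ?_⟩
  intro v hv v' hv' ⟨j, hj, hjlt⟩
  obtain ⟨hvB, u, hu, huv⟩ := mem_Sh.1 hv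
  rw [mem_Sh]
  refine ⟨hv', ?_⟩
  have huv : ∀ i, u i ≤ v i := huv
  obtain ⟨s, hs, hmax⟩ := Finset.exists_max_image (Finset.univ.filter (fun i => 0 < v' i)) id
    ⟨j, by simp; omega⟩
  simp only [Finset.mem_filter, Finset.mem_univ, true_and, id] at hs hmax
  have hu' := dec_mem hv' s hs
  set u' := Function.update v' s (v' s - 1) with hu'def
  refine ⟨u', ?_, dec_le _ _⟩
  have huB := hA.1 hu
  rcases LLt.tri u u' with h | h | h
  · exact hA.2 u hu u' hu' h
  · exact h ▸ hu
  · exfalso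
    obtain ⟨i, hi, hilt⟩ := h
    have h0 : ∀ k, s < k → u' k = 0 := by
      intro k hk
      have : v' k = 0 := by
        by_contra hne
        exact absurd (hmax k (by omega)) (not_le.2 hk)
      rw [hu'def, Function.update_of_ne (ne_of_gt hk), this]
    have h1 : ∀ k, k < s → u' k = v' k := by
      intro k hk
      rw [hu'def, Function.update_of_ne (ne_of_lt hk)]
    rcases lt_or_ge i s with his | his
    · rcases lt_trichotomy i j with hij | hij | hij
      · have := h1 i his; have := hj i hij; have := huv i; omega
      · subst hij; have := h1 i his; have := huv i; omega
      · have := h1 j (hij.trans his); have := hi j hij; have := huv j; omega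
    · have hle : u' ≤ u := by
        intro k
        rcases lt_trichotomy k i with hk | hk | hk
        · exact (hi k hk).le
        · subst hk; exact hilt.le
        · rw [h0 k (lt_of_le_of_lt his hk)]; exact Nat.zero_le _
      have := not_le_of_sum ((mem_Bx.1 hu').2.trans (mem_Bx.1 huB).2.symm) hle
      rw [this] at hilt; omega

end EGH

namespace EGH
open Finset

/-- rank -/
def rk {ι : Type*} (F : Finset ι) (f : ι → ℕ) (x : ι) : ℕ := (F.filter (fun y => f y < f x)).card

theorem rk_le {ι : Type*} {F : Finset ι} {f : ι → ℕ} {x y : ι} (h : f x ≤ f y) :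
    rk F f x ≤ rk F f y := by
  apply Finset.card_le_card
  intro z hz
  simp only [Finset.mem_filter] at *
  exact ⟨hz.1, by omega⟩

theorem rk_lt_card {ι : Type*} {F : Finset ι} {f : ι → ℕ} {x : ι} (h : x ∈ F) :
    rk F f x < F.card := by
  apply Finset.card_lt_card
  refine ⟨Finset.filter_subset _ _, fun h' => ?_⟩
  have := h' h
  simp at this

theorem rk_lt {ι : Type*} {F : Finset ι} {f : ι → ℕ} {x y : ι} (hx : x ∈ F) (h : f x < f y) :
    rk F f x < rk F f y := by
  apply Finset.card_lt_card
  refine ⟨?_, fun h' => ?_⟩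
  · intro z hz
    simp only [Finset.mem_filter] at *
    exact ⟨hz.1, by omega⟩
  · have := h' (Finset.mem_filter.2 ⟨hx, h⟩)
    simp at this

theorem rk_injOn {ι : Type*} {F : Finset ι} {f : ι → ℕ} (hf : Set.InjOn f F) :
    Set.InjOn (rk F f) F := by
  intro x hx y hy h
  apply hf hx hy
  rcases lt_trichotomy (f x) (f y) with h' | h' | h'
  · have := rk_lt hx h'; omega
  · exact h'
  · have := rk_lt hy h'; omega

theorem card_le_of_rk {ι : Type*} {F S : Finset ι} {f : ι → ℕ} (hf : Set.InjOn f F) (hS : S ⊆ F)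
    {N : ℕ} (h : ∀ x ∈ S, rk F f x < N) : S.card ≤ N := by
  have := Finset.card_le_card_of_injOn (s := S) (t := Finset.range N) (rk F f)
    (fun x hx => by simpa using h x hx) ((rk_injOn hf).mono (by exact_mod_cast hS))
  simpa using this

theorem bot_card {ι : Type*} {F : Finset ι} {f : ι → ℕ} (hf : Set.InjOn f F) {c : ℕ}
    (hc : c ≤ F.card) : (F.filter (fun x => rk F f x < c)).card = c := by
  classical
  apply le_antisymm
  · exact card_le_of_rk hf (Finset.filter_subset _ _) (fun x hx => (Finset.mem_filter.1 hx).2)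
  · have h1 : F.image (rk F f) = Finset.range F.card := by
      apply Finset.eq_of_subset_of_card_le
      · intro r hr
        obtain ⟨x, hx, rfl⟩ := Finset.mem_image.1 hr
        simpa using rk_lt_card hx
      · rw [Finset.card_image_of_injOn (rk_injOn hf)]; simp
    have h2 : Finset.range c ⊆ (F.filter (fun x => rk F f x < c)).image (rk F f) := by
      intro r hr
      have hr' : r ∈ F.image (rk F f) := by
        rw [h1]; simp at *; omega
      obtain ⟨x, hx, rfl⟩ := Finset.mem_image.1 hr'
      exact Finset.mem_image.2 ⟨x, Finset.mem_filter.2 ⟨hx, by simpa using hr⟩, rfl⟩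
    have := (Finset.card_le_card h2).trans Finset.card_image_le
    simpa using this

theorem bot_sum {ι : Type*} {F : Finset ι} {f : ι → ℕ} (hf : Set.InjOn f F) {S : Finset ι}
    (hS : S ⊆ F) : ∑ x ∈ F.filter (fun x => rk F f x < S.card), f x ≤ ∑ x ∈ S, f x ∧
    (F.filter (fun x => rk F f x < S.card) ≠ S →
      ∑ x ∈ F.filter (fun x => rk F f x < S.card), f x < ∑ x ∈ S, f x) := by
  classical
  have hcard := bot_card hf (Finset.card_le_card hS)
  set T := F.filter (fun x => rk F f x < S.card) with hT
  have key : T ≠ S → ∑ x ∈ T, f x < ∑ x ∈ S, f x := by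
    intro hne
    have e1 := Finset.card_sdiff_add_card_inter T S
    have e2 := Finset.card_sdiff_add_card_inter S T
    rw [Finset.inter_comm] at e2
    have hne' : (S \ T).Nonempty := by
      rw [Finset.sdiff_nonempty]
      intro h
      exact hne (Finset.eq_of_subset_of_card_le h (by omega)).symm
    obtain ⟨x0, hx0, hmin⟩ := Finset.exists_min_image (S \ T) f hne'
    have hlt : ∀ y ∈ T \ S, f y < f x0 := by
      intro y hy
      by_contra hcon
      simp only [Finset.mem_sdiff] at hy hx0
      have := rk_le (F := F) (not_lt.1 hcon)
      have h1 := (Finset.mem_filter.1 hy.1).2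
      apply hx0.2
      rw [hT, Finset.mem_filter]
      exact ⟨hS hx0.1, by omega⟩
    have hneT : (T \ S).Nonempty := by
      rw [← Finset.card_pos] at *; omega
    have s1 : ∑ x ∈ T \ S, f x < (T \ S).card * f x0 := by
      rw [← smul_eq_mul, ← Finset.sum_const]
      exact Finset.sum_lt_sum_of_nonempty hneT hlt
    have s2 : (S \ T).card * f x0 ≤ ∑ x ∈ S \ T, f x := by
      rw [← smul_eq_mul, ← Finset.sum_const]
      exact Finset.sum_le_sum hmin
    have s3 := Finset.sum_inter_add_sum_sdiff T S f
    have s4 := Finset.sum_inter_add_sum_sdiff S T f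
    rw [Finset.inter_comm] at s4
    have : (T \ S).card = (S \ T).card := by omega
    rw [this] at s1
    omega
  refine ⟨?_, key⟩
  by_cases h : T = S
  · rw [h]
  · exact (key h).le

/-- line -/
def line (a b e : ℕ) : Finset ℕ := (Finset.range (e+1)).filter (fun x => x < b ∧ e - x < a)

theorem mem_line {a b e x : ℕ} : x ∈ line a b e ↔ x ≤ e ∧ x < b ∧ e - x < a := by
  simp [line, Nat.lt_succ_iff]

open Classical in
/-- 2d shadow -/
noncomputable def TT (a b e : ℕ) (A : Finset ℕ) : Finset ℕ :=
  (line a b (e+1)).filter (fun x => x ∈ A ∨ ∃ y ∈ A, x = y + 1)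

theorem two_dim {a b e : ℕ} (hab : a ≤ b) {A : Finset ℕ} (hA : A ⊆ line a b e) {x y : ℕ}
    (hx : x ∈ line a b e) (hr : rk (line a b e) id x < A.card) (hy : y ∈ line a b (e+1))
    (hxy : y = x ∨ y = x + 1) : rk (line a b (e+1)) id y < (TT a b e A).card := by
  classical
  by_cases hfull : TT a b e A = line a b (e+1)
  · rw [hfull]; exact rk_lt_card hy
  by_cases hea : e + 1 < a
  · have hne : A.Nonempty := by rw [← Finset.card_pos]; omega
    obtain ⟨m, hm, hmax⟩ := Finset.exists_max_image A id hne
    have h1 : insert (m+1) A ⊆ TT a b e A := by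
      intro z hz
      rw [TT, Finset.mem_filter, mem_line]
      rcases Finset.mem_insert.1 hz with rfl | hz
      · have := mem_line.1 (hA hm)
        exact ⟨by omega, Or.inr ⟨m, hm, rfl⟩⟩
      · have := mem_line.1 (hA hz)
        exact ⟨by omega, Or.inl hz⟩
    have h2 := Finset.card_le_card h1
    rw [Finset.card_insert_of_notMem (fun h => by have := hmax _ h; simp at this)] at h2
    have h3 : rk (line a b (e+1)) id y ≤ rk (line a b e) id x + 1 := by
      unfold rk
      have : (line a b (e+1)).filter (fun z => id z < id y) ⊆
          insert x ((line a b e).filter (fun z => id z < id x)) := by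
        intro z hz
        simp only [Finset.mem_filter, mem_line, id, Finset.mem_insert] at *
        omega
      exact (Finset.card_le_card this).trans (Finset.card_insert_le _ _)
    omega
  · have h1 : rk (line a b (e+1)) id y ≤ rk (line a b e) id x := by
      unfold rk
      apply Finset.card_le_card_of_injOn (fun z => z - 1)
      · intro z hz
        simp only [Finset.coe_filter, Set.mem_setOf_eq, mem_line, id] at *
        omega
      · intro z hz z' hz' h
        simp only [Finset.coe_filter, Set.mem_setOf_eq, mem_line, id] at *
        omega
    have h2 : A.card ≤ (TT a b e A).card := by
      have : ∃ g ∈ line a b (e+1), g ∉ TT a b e A := by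
        by_contra! hcon
        exact hfull (Finset.Subset.antisymm (Finset.filter_subset _ _) hcon)
      obtain ⟨g, hg, hgT⟩ := this
      have hgA : g ∉ A := fun h => hgT (by rw [TT, Finset.mem_filter]; exact ⟨hg, Or.inl h⟩)
      have hgA' : ∀ z ∈ A, g ≠ z + 1 := fun z hz h => hgT (by
        rw [TT, Finset.mem_filter]; exact ⟨hg, Or.inr ⟨z, hz, h⟩⟩)
      apply Finset.card_le_card_of_injOn (fun z => if z < g then z + 1 else z)
      · intro z hz
        have hz' := mem_line.1 (hA hz)
        have hg' := mem_line.1 hg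
        have := hgA' z hz
        have hzg : z ≠ g := fun h => hgA (h ▸ hz)
        simp only [TT, Finset.coe_filter, Set.mem_setOf_eq, mem_line]
        split_ifs with h
        · exact ⟨by omega, Or.inr ⟨z, hz, rfl⟩⟩
        · exact ⟨by omega, Or.inl hz⟩
      · intro z hz z' hz' h
        have := hgA' z hz
        have hzg : z ≠ g := fun h => hgA (h ▸ hz)
        have := hgA' z' hz'
        have hzg' : z' ≠ g := fun h => hgA (h ▸ hz')
        simp only at h
        split_ifs at h <;> omega
    omega

end EGH

namespace EGH
open Finset

theorem rk_image {ι : Type*} {F : Finset ι} {f : ι → ℕ} (hf : Set.InjOn f F) (x : ι) :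
    rk F f x = rk (F.image f) id (f x) := by
  classical
  unfold rk
  rw [Finset.filter_image, Finset.card_image_of_injOn]
  · rfl
  · exact hf.mono (by intro z hz; simp at hz ⊢; exact hz.1)

/-- key -/
def key {n : ℕ} (j l : Fin n) (w : Fin n → ℕ) : Fin n → ℕ :=
  Function.update (Function.update w j 0) l 0

theorem key_eq_iff {n : ℕ} {j l : Fin n} {u w : Fin n → ℕ} :
    key j l u = key j l w ↔ ∀ k, k ≠ j → k ≠ l → u k = w k := by
  constructor
  · intro h k hj hl
    have := congrFun h k
    simpa [key, hj, hl] using this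
  · intro h
    ext k
    by_cases hl : k = l
    · subst hl; simp [key]
    by_cases hj : k = j
    · subst hj; simp [key, hl]
    simp [key, hj, hl, h k hj hl]

theorem sum_key {n : ℕ} {j l : Fin n} (hjl : j ≠ l) (w : Fin n → ℕ) :
    ∑ i, w i = ∑ i, key j l w i + w j + w l := by
  have h1 := sum_update w j 0
  have h2 := sum_update (Function.update w j 0) l 0
  rw [Function.update_of_ne hjl.symm] at h2
  unfold key
  omega

/-- fiber -/
def Fib {n : ℕ} (a : Fin n → ℕ) (d : ℕ) (j l : Fin n) (m : Fin n → ℕ) : Finset (Fin n → ℕ) :=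
  (Bx a d).filter (fun w => key j l w = m)

theorem mem_Fib {n : ℕ} {a : Fin n → ℕ} {d : ℕ} {j l : Fin n} {m w : Fin n → ℕ} :
    w ∈ Fib a d j l m ↔ w ∈ Bx a d ∧ key j l w = m := by simp [Fib]

theorem Fib_sum {n : ℕ} {a : Fin n → ℕ} {d : ℕ} {j l : Fin n} (hjl : j ≠ l) {m w : Fin n → ℕ}
    (hw : w ∈ Fib a d j l m) : d = ∑ i, m i + w j + w l := by
  rw [mem_Fib] at hw
  rw [← (mem_Bx.1 hw.1).2, sum_key hjl w, hw.2]

theorem Fib_inj {n : ℕ} {a : Fin n → ℕ} {d : ℕ} {j l : Fin n} (hjl : j ≠ l) (m : Fin n → ℕ) :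
    Set.InjOn (fun w : Fin n → ℕ => w l) (Fib a d j l m) := by
  intro u hu w hw h
  rw [Finset.mem_coe] at hu hw
  have h1 := Fib_sum hjl hu
  have h2 := Fib_sum hjl hw
  have h3 := key_eq_iff.1 ((mem_Fib.1 hu).2.trans (mem_Fib.1 hw).2.symm)
  simp only at h
  ext k
  by_cases hl : k = l
  · subst hl; exact h
  by_cases hj : k = j
  · subst hj; omega
  exact h3 k hj hl

theorem Fib_image {n : ℕ} {a : Fin n → ℕ} {d : ℕ} {j l : Fin n} (hjl : j ≠ l) {u : Fin n → ℕ}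
    (hu : u ∈ Bx a d) :
    (Fib a d j l (key j l u)).image (fun w => w l) = line (a j) (a l) (u j + u l) := by
  have hu' := Fib_sum hjl (mem_Fib.2 ⟨hu, rfl⟩ : u ∈ Fib a d j l (key j l u))
  ext x
  rw [Finset.mem_image, mem_line]
  constructor
  · rintro ⟨w, hw, rfl⟩
    have h1 := Fib_sum hjl hw
    have h2 := (mem_Bx.1 (mem_Fib.1 hw).1).1
    have := h2 j
    have := h2 l
    omega
  · intro hx
    refine ⟨Function.update (Function.update u j (u j + u l - x)) l x, ?_, by simp⟩
    rw [mem_Fib, mem_Bx, key_eq_iff]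
    refine ⟨⟨?_, ?_⟩, ?_⟩
    · intro k
      by_cases hl : k = l
      · subst hl; simp; omega
      by_cases hj : k = j
      · subst hj; simp [hl]; omega
      simp [hl, hj]; exact (mem_Bx.1 hu).1 k
    · have h1 := sum_update u j (u j + u l - x)
      have h2 := sum_update (Function.update u j (u j + u l - x)) l x
      rw [Function.update_of_ne hjl.symm] at h2
      have := (mem_Bx.1 hu).2
      omega
    · intro k hj hl
      simp [hj, hl]

open Classical in
/-- compression -/
noncomputable def Cp {n : ℕ} (a : Fin n → ℕ) (d : ℕ) (j l : Fin n) (C : Finset (Fin n → ℕ)) :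
    Finset (Fin n → ℕ) :=
  (Bx a d).filter (fun w => rk (Fib a d j l (key j l w)) (fun w => w l) w <
    (C.filter (fun u => key j l u = key j l w)).card)

theorem Cp_fib {n : ℕ} {a : Fin n → ℕ} {d : ℕ} {j l : Fin n} {C : Finset (Fin n → ℕ)} (m) :
    (Cp a d j l C).filter (fun u => key j l u = m) =
    (Fib a d j l m).filter (fun w => rk (Fib a d j l m) (fun w => w l) w <
      (C.filter (fun u => key j l u = m)).card) := by
  ext w
  rw [Finset.mem_filter, Cp, Finset.mem_filter, Finset.mem_filter, mem_Fib]
  constructor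
  · rintro ⟨⟨h1, h2⟩, rfl⟩; exact ⟨⟨h1, rfl⟩, h2⟩
  · rintro ⟨⟨h1, rfl⟩, h2⟩; exact ⟨⟨h1, h2⟩, rfl⟩

theorem C_fib_sub {n : ℕ} {a : Fin n → ℕ} {d : ℕ} {j l : Fin n} {C : Finset (Fin n → ℕ)}
    (hC : C ⊆ Bx a d) (m) : C.filter (fun u => key j l u = m) ⊆ Fib a d j l m := by
  intro w hw
  simp only [Finset.mem_filter, Fib] at *
  exact ⟨hC hw.1, hw.2⟩

theorem Cp_card {n : ℕ} {a : Fin n → ℕ} {d : ℕ} {j l : Fin n} (hjl : j ≠ l)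
    {C : Finset (Fin n → ℕ)} (hC : C ⊆ Bx a d) : (Cp a d j l C).card = C.card := by
  classical
  have hmaps : ∀ D : Finset (Fin n → ℕ), D ⊆ Bx a d →
      (D : Set (Fin n → ℕ)).MapsTo (key j l) ((Bx a d).image (key j l)) := by
    intro D hD w hw
    simp only [Finset.coe_image]
    exact ⟨w, hD hw, rfl⟩
  rw [Finset.card_eq_sum_card_fiberwise (hmaps _ hC),
    Finset.card_eq_sum_card_fiberwise (hmaps (Cp a d j l C) (Finset.filter_subset _ _))]
  apply Finset.sum_congr rfl
  intro m _
  rw [Cp_fib]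
  exact bot_card (Fib_inj hjl m) (Finset.card_le_card (C_fib_sub hC m))

theorem Cp_sum {n : ℕ} {a : Fin n → ℕ} {d : ℕ} {j l : Fin n} (hjl : j ≠ l)
    {C : Finset (Fin n → ℕ)} (hC : C ⊆ Bx a d) (hne : Cp a d j l C ≠ C) :
    ∑ w ∈ Cp a d j l C, w l < ∑ w ∈ C, w l := by
  classical
  have hmaps : ∀ D : Finset (Fin n → ℕ), D ⊆ Bx a d →
      ∀ w ∈ D, key j l w ∈ ((Bx a d).image (key j l)) := by
    intro D hD w hw
    exact Finset.mem_image_of_mem _ (hD hw)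
  have hs : Cp a d j l C ⊆ Bx a d := Finset.filter_subset _ _
  rw [← Finset.sum_fiberwise_of_maps_to (hmaps _ hC),
    ← Finset.sum_fiberwise_of_maps_to (hmaps _ hs)]
  have hex : ∃ m, (Cp a d j l C).filter (fun u => key j l u = m) ≠ C.filter (fun u => key j l u = m) := by
    by_contra! hcon
    apply hne
    ext w
    have := hcon (key j l w)
    have h2 := Finset.ext_iff.1 this w
    simpa using h2
  apply Finset.sum_lt_sum
  · intro m _
    rw [Cp_fib]
    exact (bot_sum (Fib_inj hjl m) (C_fib_sub hC m)).1
  · obtain ⟨m, hm⟩ := hex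
    refine ⟨m, ?_, ?_⟩
    · by_contra hcon
      apply hm
      have : ∀ D : Finset (Fin n → ℕ), D ⊆ Bx a d → D.filter (fun u => key j l u = m) = ∅ := by
        intro D hD
        apply Finset.filter_eq_empty_iff.2
        intro w hw h
        exact hcon (h ▸ hmaps D hD w hw)
      rw [this _ hC, this _ hs]
    · rw [Cp_fib] at hm ⊢
      exact (bot_sum (Fib_inj hjl m) (C_fib_sub hC m)).2 hm

theorem eq_inc {n : ℕ} {a : Fin n → ℕ} {d : ℕ} {u v : Fin n → ℕ} (hu : u ∈ Bx a d)
    (hv : v ∈ Bx a (d+1)) (huv : u ≤ v) (k : Fin n) (hk : u k ≠ v k) :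
    v = Function.update u k (u k + 1) := by
  symm
  have huv' : ∀ i, u i ≤ v i := huv
  apply not_le_of_sum
  · have := sum_update u k (u k + 1)
    have := (mem_Bx.1 hu).2
    have := (mem_Bx.1 hv).2
    omega
  · intro i
    by_cases h : i = k
    · subst h; simp; have := huv' i; omega
    · simp [h]; exact huv' i

theorem Cp_Sh {n : ℕ} {a : Fin n → ℕ} {d : ℕ} {j l : Fin n} (hjl : j ≠ l) (hal : a j ≤ a l)
    {C : Finset (Fin n → ℕ)} (hC : C ⊆ Bx a d) :
    (Sh a d (Cp a d j l C)).card ≤ (Sh a d C).card := by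
  classical
  have hmaps : ∀ D : Finset (Fin n → ℕ),
      ((Sh a d D : Finset _) : Set (Fin n → ℕ)).MapsTo (key j l) ((Bx a (d+1)).image (key j l)) := by
    intro D w hw
    simp only [Finset.coe_image]
    exact ⟨w, (mem_Sh.1 hw).1, rfl⟩
  rw [Finset.card_eq_sum_card_fiberwise (hmaps C),
    Finset.card_eq_sum_card_fiberwise (hmaps (Cp a d j l C))]
  apply Finset.sum_le_sum
  intro m _
  apply card_le_of_rk (Fib_inj (a := a) (d := d+1) hjl m)
  · exact C_fib_sub (fun v hv => (mem_Sh.1 hv).1) m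
  intro v hv
  rw [Finset.mem_filter, mem_Sh] at hv
  obtain ⟨⟨hvB, u, hu, huv⟩, rfl⟩ := hv
  have huv' : ∀ i, u i ≤ v i := huv
  have hu2 := hu
  rw [Cp, Finset.mem_filter] at hu
  obtain ⟨huB, hur⟩ := hu
  by_cases hk : key j l u = key j l v
  · have hvF : v ∈ Fib a (d+1) j l (key j l v) := mem_Fib.2 ⟨hvB, rfl⟩
    have huF : u ∈ Fib a d j l (key j l u) := mem_Fib.2 ⟨huB, rfl⟩
    have s1 := Fib_sum hjl hvF
    have s2 := Fib_sum hjl huF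
    rw [hk] at s2
    have hE : v j + v l = u j + u l + 1 := by omega
    have i1 := Fib_image (j := j) (l := l) hjl hvB
    have i2 := Fib_image (j := j) (l := l) hjl huB
    rw [hE] at i1
    set A := (C.filter (fun w => key j l w = key j l u)).image (fun w => w l) with hA
    have hAc : A.card = (C.filter (fun w => key j l w = key j l u)).card :=
      Finset.card_image_of_injOn ((Fib_inj hjl (key j l u)).mono (by exact_mod_cast C_fib_sub hC _))
    rw [rk_image (Fib_inj hjl _), i1]
    rw [rk_image (Fib_inj hjl _), i2, ← hAc] at hur
    have hAs : A ⊆ line (a j) (a l) (u j + u l) := by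
      rw [← i2]; exact Finset.image_subset_image (C_fib_sub hC _)
    refine lt_of_lt_of_le (two_dim hal hAs ?_ hur ?_ ?_) ?_
    · rw [← i2]; exact Finset.mem_image_of_mem _ huF
    · rw [← i1]; exact Finset.mem_image_of_mem _ hvF
    · have := huv' l; have := huv' j; omega
    · refine le_trans (Finset.card_le_card ?_) (Finset.card_image_le (f := fun w : Fin n → ℕ => w l))
      intro g hg
      rw [TT, Finset.mem_filter, ← i1] at hg
      obtain ⟨hg1, hg2⟩ := hg
      obtain ⟨v', hv', rfl⟩ := Finset.mem_image.1 hg1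
      refine Finset.mem_image_of_mem _ ?_
      rw [Finset.mem_filter, mem_Sh]
      refine ⟨⟨(mem_Fib.1 hv').1, ?_⟩, (mem_Fib.1 hv').2⟩
      have hex : ∃ u' ∈ C.filter (fun w => key j l w = key j l u), v' l = u' l ∨ v' l = u' l + 1 := by
        rcases hg2 with h | ⟨y, hy, h⟩
        · obtain ⟨u', h1, h2⟩ := Finset.mem_image.1 h
          exact ⟨u', h1, Or.inl h2.symm⟩
        · obtain ⟨u', h1, rfl⟩ := Finset.mem_image.1 hy
          exact ⟨u', h1, Or.inr h⟩
      obtain ⟨u', hu', hor⟩ := hex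
      refine ⟨u', (Finset.mem_filter.1 hu').1, ?_⟩
      have s3 := Fib_sum hjl hv'
      have s4 := Fib_sum hjl (C_fib_sub hC _ hu')
      rw [hk] at s4
      have := key_eq_iff.1 ((Finset.mem_filter.1 hu').2.trans (hk.trans (mem_Fib.1 hv').2.symm))
      intro k
      by_cases hl : k = l
      · subst hl; show u' k ≤ v' k; omega
      by_cases hj : k = j
      · subst hj; show u' k ≤ v' k; omega
      exact (this k hj hl).le
  · have hex : ∃ k, k ≠ j ∧ k ≠ l ∧ u k ≠ v k := by
      by_contra! hcon
      exact hk (key_eq_iff.2 hcon)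
    obtain ⟨k, hkj, hkl, hkne⟩ := hex
    have hvu := eq_inc huB hvB huv k hkne
    have hvk : v k = u k + 1 := by rw [hvu]; simp
    have hoff : ∀ i, i ≠ k → v i = u i := by
      intro i hi; rw [hvu]; simp [hi]
    have hr1 : rk (Fib a (d+1) j l (key j l v)) (fun w => w l) v ≤
        rk (Fib a d j l (key j l u)) (fun w => w l) u := by
      unfold rk
      apply Finset.card_le_card_of_injOn (fun w => Function.update w k (w k - 1))
      · intro w hw
        rw [Finset.mem_coe, Finset.mem_filter, mem_Fib, key_eq_iff] at hw
        obtain ⟨⟨hw1, hw2⟩, hw3⟩ := hw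
        rw [Finset.mem_coe, Finset.mem_filter, mem_Fib, key_eq_iff]
        refine ⟨⟨dec_mem hw1 k (by rw [hw2 k hkj hkl]; omega), ?_⟩, ?_⟩
        · intro i hij hil
          by_cases hik : i = k
          · subst hik; simp; rw [hw2 i hij hil]; omega
          · simp [hik]; rw [hw2 i hij hil, hoff i hik]
        · simp only [ne_eq, hkl.symm, not_false_eq_true, Function.update_of_ne]
          have hw3 : w l < v l := hw3
          rw [hoff l hkl.symm] at hw3; exact hw3
      · intro w hw w' hw' h
        rw [Finset.mem_coe, Finset.mem_filter, mem_Fib, key_eq_iff] at hw hw'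
        ext i
        by_cases hik : i = k
        · subst hik; rw [hw.1.2 i hkj hkl, hw'.1.2 i hkj hkl]
        · have := congrFun h i
          simpa [hik] using this
    have hr2 : (C.filter (fun w => key j l w = key j l u)).card ≤
        ((Sh a d C).filter (fun w => key j l w = key j l v)).card := by
      apply Finset.card_le_card_of_injOn (fun w => Function.update w k (w k + 1))
      · intro w hw
        rw [Finset.mem_coe, Finset.mem_filter, key_eq_iff] at hw
        rw [Finset.mem_coe, Finset.mem_filter, key_eq_iff, mem_Sh]
        refine ⟨⟨inc_mem (hC hw.1) k ?_, w, hw.1, inc_le _ _⟩, ?_⟩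
        · rw [hw.2 k hkj hkl, ← hvk]; exact (mem_Bx.1 hvB).1 k
        · intro i hij hil
          by_cases hik : i = k
          · subst hik; simp; rw [hw.2 i hij hil, hvk]
          · simp [hik]; rw [hw.2 i hij hil, hoff i hik]
      · intro w hw w' hw' h
        rw [Finset.mem_coe, Finset.mem_filter, key_eq_iff] at hw hw'
        ext i
        by_cases hik : i = k
        · subst hik; rw [hw.2 i hkj hkl, hw'.2 i hkj hkl]
        · have := congrFun h i
          simpa [hik] using this
    omega

/-- stability of fixed sets -/
theorem Cp_stable {n : ℕ} {a : Fin n → ℕ} {d : ℕ} {j l : Fin n}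
    {C : Finset (Fin n → ℕ)} (hfix : Cp a d j l C = C) {w w' : Fin n → ℕ}
    (hw : w ∈ C) (hw' : w' ∈ Bx a d) (hk : key j l w' = key j l w) (hlt : w' l ≤ w l) : w' ∈ C := by
  rw [← hfix, Cp, Finset.mem_filter] at hw ⊢
  refine ⟨hw', ?_⟩
  rw [hk]
  exact lt_of_le_of_lt (rk_le hlt) hw.2

end EGH

namespace EGH
open Finset

theorem snoc_mem_Bx {n : ℕ} {a : Fin (n+1) → ℕ} {d i : ℕ} {w : Fin n → ℕ} :
    (Fin.snoc w i : Fin (n+1) → ℕ) ∈ Bx a d ↔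
      w ∈ Bx (Fin.init a) (d - i) ∧ i < a (Fin.last n) ∧ i ≤ d := by
  rw [mem_Bx, mem_Bx, Fin.sum_univ_castSucc, Fin.forall_fin_succ']
  simp only [Fin.snoc_castSucc, Fin.snoc_last, Fin.init]
  constructor
  · rintro ⟨⟨h1, h2⟩, h3⟩; exact ⟨⟨h1, by omega⟩, h2, by omega⟩
  · rintro ⟨⟨h1, h3⟩, h2, h4⟩; exact ⟨⟨h1, h2⟩, by omega⟩

theorem mem_Bx_init {n : ℕ} {a : Fin (n+1) → ℕ} {d : ℕ} {w : Fin (n+1) → ℕ} :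
    w ∈ Bx a d ↔ Fin.init w ∈ Bx (Fin.init a) (d - w (Fin.last n)) ∧
      w (Fin.last n) < a (Fin.last n) ∧ w (Fin.last n) ≤ d := by
  conv_lhs => rw [← Fin.snoc_init_self w]
  exact snoc_mem_Bx

/-- slices -/
def Sl {n : ℕ} (C : Finset (Fin (n+1) → ℕ)) (i : ℕ) : Finset (Fin n → ℕ) :=
  (C.filter (fun w => w (Fin.last n) = i)).image Fin.init

theorem mem_Sl {n : ℕ} {C : Finset (Fin (n+1) → ℕ)} {i : ℕ} {w : Fin n → ℕ} :
    w ∈ Sl C i ↔ (Fin.snoc w i : Fin (n+1) → ℕ) ∈ C := by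
  rw [Sl, Finset.mem_image]
  constructor
  · rintro ⟨v, hv, rfl⟩
    rw [Finset.mem_filter] at hv
    rw [← hv.2, Fin.snoc_init_self]; exact hv.1
  · intro h
    exact ⟨_, Finset.mem_filter.2 ⟨h, by simp⟩, by simp⟩

theorem card_Sl {n : ℕ} (C : Finset (Fin (n+1) → ℕ)) (i : ℕ) :
    (Sl C i).card = (C.filter (fun w => w (Fin.last n) = i)).card := by
  apply Finset.card_image_of_injOn
  intro u hu w hw h
  rw [Finset.mem_coe, Finset.mem_filter] at hu hw
  rw [← Fin.snoc_init_self u, ← Fin.snoc_init_self w, h, hu.2, hw.2]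

theorem Sl_sub {n : ℕ} {a : Fin (n+1) → ℕ} {d : ℕ} {C : Finset (Fin (n+1) → ℕ)} (hC : C ⊆ Bx a d)
    (i : ℕ) : Sl C i ⊆ Bx (Fin.init a) (d - i) := by
  intro w hw
  exact (snoc_mem_Bx.1 (hC (mem_Sl.1 hw))).1

theorem snoc_le {n : ℕ} {u v : Fin n → ℕ} {i j : ℕ} :
    (Fin.snoc u i : Fin (n+1) → ℕ) ≤ Fin.snoc v j ↔ u ≤ v ∧ i ≤ j := by
  rw [Pi.le_def, Fin.forall_fin_succ', Pi.le_def]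
  simp

theorem snoc_LLt {n : ℕ} {u v : Fin n → ℕ} {i : ℕ} :
    LLt (Fin.snoc u i : Fin (n+1) → ℕ) (Fin.snoc v i) ↔ LLt u v := by
  constructor
  · rintro ⟨k, hk, hlt⟩
    refine Fin.lastCases ?_ ?_ k hk hlt
    · intro _ h; simp at h
    · intro k hk hlt
      refine ⟨k, fun j hj => ?_, by simpa using hlt⟩
      simpa using hk j.castSucc (by simpa using hj)
  · rintro ⟨k, hk, hlt⟩
    refine ⟨k.castSucc, fun j => ?_, by simpa using hlt⟩
    refine Fin.lastCases ?_ ?_ j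
    · intro _; simp
    · intro j hj; simpa using hk j (by simpa using hj)

theorem Sl_seg {n : ℕ} {a : Fin (n+1) → ℕ} {d : ℕ} {A : Finset (Fin (n+1) → ℕ)} (hA : IsSeg a d A)
    {i : ℕ} (hi : i < a (Fin.last n)) (hd : i ≤ d) : IsSeg (Fin.init a) (d - i) (Sl A i) := by
  refine ⟨Sl_sub hA.1 i, ?_⟩
  intro u hu w hw h
  rw [mem_Sl] at *
  exact hA.2 _ hu _ (snoc_mem_Bx.2 ⟨hw, hi, hd⟩) (snoc_LLt.2 h)

theorem count_ge {n : ℕ} {a : Fin (n+1) → ℕ} {d : ℕ} {C : Finset (Fin (n+1) → ℕ)} (hC : C ⊆ Bx a d) :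
    (Sh (Fin.init a) d (Sl C 0)).card +
      (C.filter (fun w => w (Fin.last n) + 1 < a (Fin.last n))).card ≤ (Sh a d C).card := by
  classical
  have h1 : (Sh (Fin.init a) d (Sl C 0)).card ≤
      ((Sh a d C).filter (fun w => w (Fin.last n) = 0)).card := by
    apply Finset.card_le_card_of_injOn (fun w => (Fin.snoc w 0 : Fin (n+1) → ℕ))
    · intro v hv
      rw [Finset.mem_coe, mem_Sh] at hv
      obtain ⟨hv, u, hu, huv⟩ := hv
      have hu' := mem_Sl.1 hu
      have := snoc_mem_Bx.1 (hC hu')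
      rw [Finset.mem_coe, Finset.mem_filter, mem_Sh]
      exact ⟨⟨snoc_mem_Bx.2 ⟨hv, this.2.1, by omega⟩, _, hu', snoc_le.2 ⟨huv, le_rfl⟩⟩, by simp⟩
    · intro u _ w _ h
      have := congrArg Fin.init h
      simpa using this
  have h2 : (C.filter (fun w => w (Fin.last n) + 1 < a (Fin.last n))).card ≤
      ((Sh a d C).filter (fun w => ¬ w (Fin.last n) = 0)).card := by
    apply Finset.card_le_card_of_injOn (fun w => Function.update w (Fin.last n) (w (Fin.last n) + 1))
    · intro v hv
      rw [Finset.mem_coe, Finset.mem_filter] at hv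
      rw [Finset.mem_coe, Finset.mem_filter, mem_Sh]
      exact ⟨⟨inc_mem (hC hv.1) _ hv.2, v, hv.1, inc_le _ _⟩, by simp⟩
    · intro u _ w _ h
      ext i
      have := congrFun h i
      by_cases hi : i = Fin.last n
      · subst hi; simpa using this
      · simpa [hi] using this
  have := Finset.card_filter_add_card_filter_not (s := Sh a d C) (fun w => w (Fin.last n) = 0)
  omega

theorem count_le {n : ℕ} {a : Fin (n+1) → ℕ} {d : ℕ} {A : Finset (Fin (n+1) → ℕ)} (hA : IsSeg a d A) :
    (Sh a d A).card ≤ (Sh (Fin.init a) d (Sl A 0)).card +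
      (A.filter (fun w => w (Fin.last n) + 1 < a (Fin.last n))).card := by
  classical
  have h1 : ((Sh a d A).filter (fun w => w (Fin.last n) = 0)).card ≤
      (Sh (Fin.init a) d (Sl A 0)).card := by
    apply Finset.card_le_card_of_injOn Fin.init
    · intro v hv
      rw [Finset.mem_coe, Finset.mem_filter, mem_Sh] at hv
      obtain ⟨⟨hv, u, hu, huv⟩, hv0⟩ := hv
      have huv' : ∀ i, u i ≤ v i := huv
      have h0 : u (Fin.last n) = 0 := by have := huv' (Fin.last n); omega
      rw [Finset.mem_coe, mem_Sh]
      have := (mem_Bx_init.1 hv).1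
      rw [hv0] at this
      refine ⟨this, Fin.init u, ?_, fun i => huv' _⟩
      rw [mem_Sl, ← h0, Fin.snoc_init_self]; exact hu
    · intro u hu w hw h
      rw [Finset.mem_coe, Finset.mem_filter] at hu hw
      rw [← Fin.snoc_init_self u, ← Fin.snoc_init_self w, h, hu.2, hw.2]
  have h2 : ((Sh a d A).filter (fun w => ¬ w (Fin.last n) = 0)).card ≤
      (A.filter (fun w => w (Fin.last n) + 1 < a (Fin.last n))).card := by
    apply Finset.card_le_card_of_injOn (fun w => Function.update w (Fin.last n) (w (Fin.last n) - 1))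
    · intro v hv
      rw [Finset.mem_coe, Finset.mem_filter, mem_Sh] at hv
      obtain ⟨⟨hv, u, hu, huv⟩, hv0⟩ := hv
      have huv' : ∀ i, u i ≤ v i := huv
      rw [Finset.mem_coe, Finset.mem_filter]
      have hlast := (mem_Bx.1 hv).1 (Fin.last n)
      refine ⟨?_, by simp; omega⟩
      have hdec := dec_mem hv (Fin.last n) (by omega)
      by_cases hl : u (Fin.last n) = v (Fin.last n)
      · have hex : ∃ k, u k ≠ v k := by
          by_contra! h
          have : u = v := funext h
          have h1 := (mem_Bx.1 (hA.1 hu)).2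
          have h2 := (mem_Bx.1 hv).2
          rw [this] at h1; omega
        obtain ⟨k, hk⟩ := hex
        have hvu := eq_inc (hA.1 hu) hv huv k hk
        have hkl : k ≠ Fin.last n := by rintro rfl; exact hk hl
        apply hA.2 u hu _ hdec
        have hlt : k < Fin.last n := Fin.lt_last_iff_ne_last.2 hkl
        refine ⟨k, fun j hj => ?_, ?_⟩
        · rw [Function.update_of_ne (hj.trans hlt).ne, hvu, Function.update_of_ne hj.ne]
        · rw [Function.update_of_ne hkl, hvu]; simp
      · have hvu := eq_inc (hA.1 hu) hv huv _ hl
        have : Function.update v (Fin.last n) (v (Fin.last n) - 1) = u := by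
          rw [hvu]; simp
        simp only
        rw [this]; exact hu
    · intro u hu w hw h
      rw [Finset.mem_coe, Finset.mem_filter] at hu hw
      ext i
      have := congrFun h i
      by_cases hi : i = Fin.last n
      · subst hi; simp at this; omega
      · simpa [hi] using this
  have := Finset.card_filter_add_card_filter_not (s := Sh a d A) (fun w => w (Fin.last n) = 0)
  omega

theorem lemA {n : ℕ} {a : Fin (n+1) → ℕ} {d : ℕ} {C : Finset (Fin (n+1) → ℕ)} (hC : C ⊆ Bx a d)
    (hst : ∀ u ∈ C, ∀ j, j ≠ Fin.last n → 0 < u (Fin.last n) → u j + 1 < a j →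
      Function.update (Function.update u j (u j + 1)) (Fin.last n) (u (Fin.last n) - 1) ∈ C)
    (hseg : ∀ u ∈ C, ∀ w ∈ Bx a d, w (Fin.last n) = u (Fin.last n) → LLt u w → w ∈ C)
    (m : ℕ) : ∀ u ∈ C, ∀ w ∈ Bx a d, u (Fin.last n) = w (Fin.last n) + m → LLt u w → w ∈ C := by
  induction m with
  | zero => intro u hu w hw h hl; exact hseg u hu w hw h.symm hl
  | succ m ih =>
    intro u hu w hw h hl
    obtain ⟨i, hi, hlt⟩ := hl
    have hil : i ≠ Fin.last n := by rintro rfl; omega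
    have main : ∀ j, j ≠ Fin.last n → u j < w j → (i ≤ j) →
      (LLt (Function.update (Function.update u j (u j + 1)) (Fin.last n) (u (Fin.last n) - 1)) w ∨
      Function.update (Function.update u j (u j + 1)) (Fin.last n) (u (Fin.last n) - 1) = w) → w ∈ C := by
      intro j hj hjw hij hor
      have hmem := hst u hu j hj (by omega) (by have := (mem_Bx.1 hw).1 j; omega)
      rcases hor with hor | hor
      · exact ih _ hmem w hw (by simp; omega) hor
      · rw [← hor]; exact hmem
    by_cases hex : ∃ j, i < j ∧ j ≠ Fin.last n ∧ u j < w j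
    · obtain ⟨j, hij, hjl, hj⟩ := hex
      refine main j hjl hj hij.le (Or.inl ⟨i, fun k hk => ?_, ?_⟩)
      · rw [Function.update_of_ne (hk.trans (Fin.lt_last_iff_ne_last.2 hil)).ne,
          Function.update_of_ne (hk.trans hij).ne]
        exact hi k hk
      · rw [Function.update_of_ne hil, Function.update_of_ne hij.ne]; exact hlt
    · push Not at hex
      refine main i hil hlt le_rfl ?_
      by_cases h2 : u i + 1 = w i
      · right
        symm
        apply not_le_of_sum
        · have h1 := sum_update u i (u i + 1)
          have h2 := sum_update (Function.update u i (u i + 1)) (Fin.last n) (u (Fin.last n) - 1)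
          rw [Function.update_of_ne hil.symm] at h2
          have := (mem_Bx.1 (hC hu)).2
          have := (mem_Bx.1 hw).2
          omega
        · intro k
          by_cases hkl : k = Fin.last n
          · subst hkl; simp; omega
          · rw [Function.update_of_ne hkl]
            rcases lt_trichotomy k i with h | h | h
            · rw [Function.update_of_ne h.ne, hi k h]
            · subst h; simp; omega
            · rw [Function.update_of_ne h.ne']; exact hex k h hkl
      · left
        refine ⟨i, fun k hk => ?_, ?_⟩
        · rw [Function.update_of_ne (hk.trans (Fin.lt_last_iff_ne_last.2 hil)).ne,
            Function.update_of_ne hk.ne]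
          exact hi k hk
        · rw [Function.update_of_ne hil]; simp; omega

theorem exists_stable {n : ℕ} {a : Fin (n+1) → ℕ} (ha : Monotone a) {d : ℕ}
    {C : Finset (Fin (n+1) → ℕ)} (hC : C ⊆ Bx a d) :
    ∃ C' ⊆ Bx a d, C'.card = C.card ∧ (Sh a d C').card ≤ (Sh a d C).card ∧
      ∀ j, j ≠ Fin.last n → Cp a d j (Fin.last n) C' = C' := by
  induction hs : ∑ w ∈ C, w (Fin.last n) using Nat.strong_induction_on generalizing C with
  | _ s ih =>
    by_cases h : ∀ j, j ≠ Fin.last n → Cp a d j (Fin.last n) C = C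
    · exact ⟨C, hC, rfl, le_rfl, h⟩
    · push Not at h
      obtain ⟨j, hj, hne⟩ := h
      have hsub : Cp a d j (Fin.last n) C ⊆ Bx a d := Finset.filter_subset _ _
      obtain ⟨C', h1, h2, h3, h4⟩ := ih _ (hs ▸ Cp_sum hj hC hne) hsub rfl
      exact ⟨C', h1, h2.trans (Cp_card hj hC), h3.trans (Cp_Sh hj (ha (Fin.le_last j)) hC), h4⟩

theorem CL {n : ℕ} : ∀ {a : Fin n → ℕ} (_ : Monotone a) {d : ℕ} {A C : Finset (Fin n → ℕ)}
    (_ : C ⊆ Bx a d) (_ : IsSeg a d A) (_ : A.card = C.card),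
    (Sh a d A).card ≤ (Sh a d C).card := by
  classical
  induction n with
  | zero =>
    intro a ha d A C hC hA hc
    have : Sh a d A = ∅ := by
      apply Finset.eq_empty_of_forall_notMem
      intro v hv
      have := (mem_Bx.1 (mem_Sh.1 hv).1).2
      simp at this
    rw [this]; simp
  | succ n IH =>
    intro a ha d A C0 hC0 hA hc0
    obtain ⟨C, hC, hcC, hShC, hfix⟩ := exists_stable ha hC0
    refine le_trans ?_ hShC
    have hc : A.card = C.card := by omega
    clear hShC hcC hc0 hC0
    have ha' : Monotone (Fin.init a : Fin n → ℕ) := fun i j h => ha (by simpa using h)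
    have hShSl : ∀ i, i + 1 ≤ d → Sh (Fin.init a) (d - (i+1)) (Sl C (i+1)) ⊆ Sl C i := by
      intro i hid v hv
      obtain ⟨hvB, u, hu, huv⟩ := mem_Sh.1 hv
      have hu' := mem_Sl.1 hu
      have huB := snoc_mem_Bx.1 (hC hu')
      have hex : ∃ k, u k ≠ v k := by
        by_contra! h
        have h0 : u = v := funext h
        have h1 := (mem_Bx.1 huB.1).2
        have h2 := (mem_Bx.1 hvB).2
        rw [h0] at h1; omega
      obtain ⟨k, hk⟩ := hex
      have hvu := eq_inc huB.1 hvB huv k hk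
      rw [mem_Sl]
      refine Cp_stable (hfix k.castSucc (Fin.castSucc_lt_last k).ne) hu' ?_ ?_ ?_
      · rw [snoc_mem_Bx]
        have : d - (i+1) + 1 = d - i := by omega
        rw [this] at hvB
        exact ⟨hvB, by omega, by omega⟩
      · rw [key_eq_iff]
        intro j
        refine Fin.lastCases ?_ ?_ j
        · intro _ h; exact absurd rfl h
        · intro j hj _
          simp only [Fin.snoc_castSucc]
          rw [hvu, Function.update_of_ne]
          rintro rfl; exact hj rfl
      · simp
    have hA' : ∀ i, ∃ B, IsSeg (Fin.init a) (d - i) B ∧ B.card = (Sl C i).card := fun i =>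
      seg_exists _ _ _ (Finset.card_le_card (Sl_sub hC i))
    choose B hB hBc using hA'
    have hShB : ∀ i, i + 1 ≤ d → Sh (Fin.init a) (d - (i+1)) (B (i+1)) ⊆ B i := by
      intro i hid
      have e : d - (i+1) + 1 = d - i := by omega
      have s1 := Sh_seg (hB (i+1))
      rw [e] at s1
      apply seg_subset s1 (hB i)
      rw [hBc i]
      exact (IH ha' (Sl_sub hC _) (hB _) (hBc _)).trans (Finset.card_le_card (hShSl i hid))
    -- the rearranged set
    set D : Finset (Fin (n+1) → ℕ) := (Bx a d).filter (fun w => Fin.init w ∈ B (w (Fin.last n))) with hD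
    have hDB : D ⊆ Bx a d := Finset.filter_subset _ _
    have hSlD : ∀ i, Sl D i = B i := by
      intro i
      ext w
      rw [mem_Sl, hD, Finset.mem_filter, snoc_mem_Bx]
      simp only [Fin.init_snoc, Fin.snoc_last]
      constructor
      · exact fun h => h.2
      · intro h
        refine ⟨⟨(hB i).1 h, ?_⟩, h⟩
        have : 0 < (Sl C i).card := by rw [← hBc]; exact Finset.card_pos.2 ⟨w, h⟩
        obtain ⟨z, hz⟩ := Finset.card_pos.1 this
        exact (snoc_mem_Bx.1 (hC (mem_Sl.1 hz))).2
    have hfil : ∀ i, (D.filter (fun w => w (Fin.last n) = i)).card =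
        (C.filter (fun w => w (Fin.last n) = i)).card := by
      intro i; rw [← card_Sl, ← card_Sl, hSlD, hBc]
    have hmaps : ∀ E : Finset (Fin (n+1) → ℕ), E ⊆ Bx a d →
        (E : Set (Fin (n+1) → ℕ)).MapsTo (fun w => w (Fin.last n)) (Finset.range (d+1)) := by
      intro E hE w hw
      have := (mem_Bx_init.1 (hE hw)).2.2
      simp; omega
    have hDC : D.card = C.card := by
      rw [Finset.card_eq_sum_card_fiberwise (hmaps C hC),
        Finset.card_eq_sum_card_fiberwise (hmaps D hDB)]
      exact Finset.sum_congr rfl fun i _ => hfil i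
    have hlemA := fun m => lemA (a := a) (d := d) hDB (by
      intro u hu j hj hpos hlt
      rw [hD, Finset.mem_filter] at hu ⊢
      have hub := mem_Bx_init.1 hu.1
      have h1 : Function.update (Function.update u j (u j + 1)) (Fin.last n) (u (Fin.last n) - 1) ∈ Bx a d := by
        have h := inc_mem hu.1 j hlt
        have := dec_mem h (Fin.last n) (by rw [Function.update_of_ne hj.symm]; exact hpos)
        rwa [Function.update_of_ne hj.symm] at this
      refine ⟨h1, ?_⟩
      simp only [Function.update_self, Fin.init_update_last]
      obtain ⟨i, hi⟩ : ∃ i, u (Fin.last n) = i + 1 := ⟨u (Fin.last n) - 1, by omega⟩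
      rw [hi, Nat.add_sub_cancel]
      apply hShB i (by omega)
      rw [mem_Sh]
      refine ⟨?_, Fin.init u, hi ▸ hu.2, ?_⟩
      · have := (mem_Bx_init.1 h1).1
        simp only [Function.update_self, Fin.init_update_last] at this
        convert this using 2
        omega
      · intro k
        exact inc_le u j k.castSucc) (by
      intro u hu w hw hl hlt
      rw [hD, Finset.mem_filter] at hu ⊢
      refine ⟨hw, ?_⟩
      rw [hl]
      refine (hB _).2 _ hu.2 _ ?_ ?_
      · have := (mem_Bx_init.1 hw).1; rwa [hl] at this
      · rw [← snoc_LLt (i := u (Fin.last n)), Fin.snoc_init_self, ← hl, Fin.snoc_init_self]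
        exact hlt) m
    have hAD : A.card = D.card := by omega
    have claim1 : (Sl A 0).card ≤ (Sl D 0).card := by
      rw [card_Sl, card_Sl]
      by_contra hcon
      have hns : ¬ A.filter (fun w => w (Fin.last n) = 0) ⊆ D.filter (fun w => w (Fin.last n) = 0) :=
        fun h => hcon (Finset.card_le_card h)
      obtain ⟨u, huA, huD⟩ := Finset.not_subset.1 hns
      rw [Finset.mem_filter] at huA huD
      have huD' : u ∉ D := fun h => huD ⟨h, huA.2⟩
      have : D ⊂ A := by
        refine (Finset.ssubset_iff_of_subset ?_).2 ⟨u, huA.1, huD'⟩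
        intro c hc
        rcases LLt.tri u c with h | h | h
        · exact hA.2 u huA.1 c (hDB hc) h
        · exact h ▸ huA.1
        · exact absurd (hlemA (c (Fin.last n)) c hc u (hA.1 huA.1) (by omega) h) huD'
      have := Finset.card_lt_card this
      omega
    have claim2 : (D.filter (fun w => w (Fin.last n) + 1 = a (Fin.last n))).card ≤
        (A.filter (fun w => w (Fin.last n) + 1 = a (Fin.last n))).card := by
      by_contra hcon
      have hns : ¬ D.filter (fun w => w (Fin.last n) + 1 = a (Fin.last n)) ⊆
        A.filter (fun w => w (Fin.last n) + 1 = a (Fin.last n)) :=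
        fun h => hcon (Finset.card_le_card h)
      obtain ⟨u, huD, huA⟩ := Finset.not_subset.1 hns
      rw [Finset.mem_filter] at huA huD
      have huA' : u ∉ A := fun h => huA ⟨h, huD.2⟩
      have : A ⊂ D := by
        refine (Finset.ssubset_iff_of_subset ?_).2 ⟨u, huD.1, huA'⟩
        intro c hc
        rcases LLt.tri u c with h | h | h
        · have := (mem_Bx.1 (hA.1 hc)).1 (Fin.last n)
          exact hlemA (u (Fin.last n) - c (Fin.last n)) u huD.1 c (hA.1 hc) (by omega) h
        · exact h ▸ huD.1
        · exact absurd (hA.2 c hc u (hDB huD.1) h) huA'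
      have := Finset.card_lt_card this
      omega
    have hconv : ∀ E : Finset (Fin (n+1) → ℕ), E ⊆ Bx a d →
        (E.filter (fun w => w (Fin.last n) + 1 = a (Fin.last n))) =
        (E.filter (fun w => w (Fin.last n) = a (Fin.last n) - 1)) := by
      intro E hE
      apply Finset.filter_congr
      intro w hw
      have := (mem_Bx.1 (hE hw)).1 (Fin.last n)
      omega
    have hsplit : ∀ E : Finset (Fin (n+1) → ℕ), E ⊆ Bx a d →
        (E.filter (fun w => w (Fin.last n) + 1 < a (Fin.last n))).card +
        (E.filter (fun w => w (Fin.last n) + 1 = a (Fin.last n))).card = E.card := by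
      intro E hE
      rw [← Finset.card_filter_add_card_filter_not (s := E)
        (fun w => w (Fin.last n) + 1 < a (Fin.last n))]
      congr 2
      apply Finset.filter_congr
      intro w hw
      have := (mem_Bx.1 (hE hw)).1 (Fin.last n)
      omega
    have claim3 : (Sh (Fin.init a) d (Sl A 0)).card ≤ (Sh (Fin.init a) d (Sl C 0)).card := by
      rcases (Sl A 0).eq_empty_or_nonempty with h0 | ⟨z, hz⟩
      · rw [h0]
        have : Sh (Fin.init a) d (∅ : Finset (Fin n → ℕ)) = ∅ := by
          apply Finset.eq_empty_of_forall_notMem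
          intro v hv
          simpa using (mem_Sh.1 hv).2
        rw [this]; simp
      · have hz' := snoc_mem_Bx.1 (hA.1 (mem_Sl.1 hz))
        have s1 := Sl_seg hA hz'.2.1 hz'.2.2
        have hsub := seg_subset s1 (hB 0) (by rw [← hSlD]; exact claim1)
        exact (Finset.card_le_card (Sh_mono hsub)).trans
          (IH ha' (Sl_sub hC 0) (hB 0) (hBc 0))
    have c1 := count_ge hC
    have c2 := count_le hA
    have s1 := hsplit A hA.1
    have s2 := hsplit C hC
    rw [hconv D hDB, hfil, ← hconv C hC] at claim2
    omega

end EGH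

namespace EGH
open Finset

section HF
variable {N : ℕ} {L : Type*} [Field L]

theorem hc_mul {p x : MvPolynomial (Fin N) L} {e : ℕ} (hp : p.IsHomogeneous e) (d : ℕ) :
    homogeneousComponent (d + e) (p * x) = p * homogeneousComponent d x := by
  conv_lhs => rw [← sum_homogeneousComponent x]
  rw [Finset.mul_sum, map_sum]
  have h1 : ∀ i ∈ Finset.range (x.totalDegree + 1),
      homogeneousComponent (d + e) (p * homogeneousComponent i x) =
        if d = i then p * homogeneousComponent i x else 0 := by
    intro i _
    have : p * homogeneousComponent i x ∈ homogeneousSubmodule (Fin N) L (i + e) := by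
      rw [mem_homogeneousSubmodule, add_comm]
      exact hp.mul (homogeneousComponent_isHomogeneous i x)
    rw [homogeneousComponent_of_mem this]
    simp
  rw [Finset.sum_congr rfl h1, Finset.sum_ite_eq]
  split_ifs with h
  · rfl
  · rw [homogeneousComponent_eq_zero, mul_zero]
    simp at h; omega

theorem hc_mul_lt {p x : MvPolynomial (Fin N) L} {e : ℕ} (hp : p.IsHomogeneous e) {d : ℕ} (hd : d < e) :
    homogeneousComponent d (p * x) = 0 := by
  rw [← sum_homogeneousComponent x, Finset.mul_sum, map_sum]
  apply Finset.sum_eq_zero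
  intro i _
  have : p * homogeneousComponent i x ∈ homogeneousSubmodule (Fin N) L (i + e) := by
    rw [mem_homogeneousSubmodule, add_comm]
    exact hp.mul (homogeneousComponent_isHomogeneous i x)
  rw [homogeneousComponent_of_mem this, if_neg (by omega)]

/-- colon -/
def col (I : Ideal (MvPolynomial (Fin N) L)) (p : MvPolynomial (Fin N) L) :
    Ideal (MvPolynomial (Fin N) L) where
  carrier := {x | p * x ∈ I}
  add_mem' := by
    intro x y hx hy
    simp only [Set.mem_ofPred_eq] at *
    rw [mul_add]; exact I.add_mem hx hy
  zero_mem' := by simp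
  smul_mem' := by
    intro c x hx
    simp only [Set.mem_ofPred_eq, smul_eq_mul] at *
    rw [mul_left_comm]; exact I.mul_mem_left _ hx

theorem mem_col {I : Ideal (MvPolynomial (Fin N) L)} {p x : MvPolynomial (Fin N) L} :
    x ∈ col I p ↔ p * x ∈ I := Iff.rfl

theorem le_col (I : Ideal (MvPolynomial (Fin N) L)) (p : MvPolynomial (Fin N) L) : I ≤ col I p :=
  fun _ hx => I.mul_mem_left _ hx

theorem col_graded {I : Ideal (MvPolynomial (Fin N) L)} (hI : IsGradedIdeal I)
    {p : MvPolynomial (Fin N) L} {e : ℕ} (hp : p.IsHomogeneous e) : IsGradedIdeal (col I p) := by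
  intro x hx d
  rw [mem_col, ← hc_mul hp]
  exact hI _ hx _

theorem sup_graded {I : Ideal (MvPolynomial (Fin N) L)} (hI : IsGradedIdeal I)
    {p : MvPolynomial (Fin N) L} {e : ℕ} (hp : p.IsHomogeneous e) :
    IsGradedIdeal (I ⊔ Ideal.span {p}) := by
  intro x hx d
  obtain ⟨y, hy, z, hz, rfl⟩ := Submodule.mem_sup.1 hx
  obtain ⟨w, rfl⟩ := Ideal.mem_span_singleton.1 hz
  rw [map_add]
  apply Ideal.add_mem
  · exact Ideal.mem_sup_left (hI y hy d)
  · apply Ideal.mem_sup_right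
    by_cases h : d < e
    · rw [hc_mul_lt hp h]; exact Ideal.zero_mem _
    · obtain ⟨c, rfl⟩ : ∃ c, d = c + e := ⟨d - e, by omega⟩
      rw [hc_mul hp]
      exact Ideal.mul_mem_right _ _ (Ideal.mem_span_singleton_self p)

instance homFin (d : ℕ) : Module.Finite L (homogeneousSubmodule (Fin N) L d) :=
  Module.Finite.of_fg (homogeneousSubmodule_fg _ _ d)

/-- `I_d` inside `S_d` -/
noncomputable def Idd (I : Ideal (MvPolynomial (Fin N) L)) (d : ℕ) :
    Submodule L (homogeneousSubmodule (Fin N) L d) :=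
  Submodule.comap (homogeneousSubmodule (Fin N) L d).subtype (Submodule.restrictScalars L I)

theorem mem_Idd {I : Ideal (MvPolynomial (Fin N) L)} {d : ℕ} {x} :
    x ∈ Idd I d ↔ (x : MvPolynomial (Fin N) L) ∈ I := Iff.rfl

theorem hilbertFn_eq (I : Ideal (MvPolynomial (Fin N) L)) (d : ℕ) :
    hilbertFn L I d = Module.finrank L (homogeneousSubmodule (Fin N) L d ⧸ Idd I d) := rfl

theorem finrank_quot_of_ker {V W : Type*} [AddCommGroup V] [Module L V] [AddCommGroup W] [Module L W]
    (f : V →ₗ[L] W) (hf : Function.Surjective f) (P : Submodule L V)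
    (h : ∀ x, f x = 0 ↔ x ∈ P) : Module.finrank L (V ⧸ P) = Module.finrank L W := by
  have : P = LinearMap.ker f := by ext x; rw [LinearMap.mem_ker, h]
  subst this
  exact (f.quotKerEquivOfSurjective hf).finrank_eq

theorem hilbertFn_mono {I J : Ideal (MvPolynomial (Fin N) L)} (h : I ≤ J) (d : ℕ) :
    hilbertFn L J d ≤ hilbertFn L I d := by
  rw [hilbertFn_eq, hilbertFn_eq]
  have h' : Idd I d ≤ Idd J d := fun x hx => h hx
  exact LinearMap.finrank_le_finrank_of_surjective (f := Submodule.factor h')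
    (Submodule.factor_surjective h')

theorem hilbertFn_top (d : ℕ) : hilbertFn L (⊤ : Ideal (MvPolynomial (Fin N) L)) d = 0 := by
  rw [hilbertFn_eq]
  have : Idd (⊤ : Ideal (MvPolynomial (Fin N) L)) d = ⊤ := by
    ext x; simp [mem_Idd]
  rw [this, Module.finrank_zero_iff]
  exact Submodule.Quotient.subsingleton_iff.2 rfl

theorem hilbertFn_eq_zero_of {I : Ideal (MvPolynomial (Fin N) L)} {d : ℕ}
    (h : ∀ x : MvPolynomial (Fin N) L, x.IsHomogeneous d → x ∈ I) : hilbertFn L I d = 0 := by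
  rw [hilbertFn_eq, Module.finrank_zero_iff]
  apply Submodule.Quotient.subsingleton_iff.2
  ext x
  simp only [mem_Idd, Submodule.mem_top, iff_true]
  exact h _ x.2

theorem hilbertFn_step {I : Ideal (MvPolynomial (Fin N) L)} (hI : IsGradedIdeal I)
    {p : MvPolynomial (Fin N) L} (hp : p.IsHomogeneous 1) (d : ℕ) :
    hilbertFn L I (d+1) = hilbertFn L (col I p) d + hilbertFn L (I ⊔ Ideal.span {p}) (d+1) := by
  let m : homogeneousSubmodule (Fin N) L d →ₗ[L] homogeneousSubmodule (Fin N) L (d+1) :=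
    ((LinearMap.mulLeft L p).comp (homogeneousSubmodule (Fin N) L d).subtype).codRestrict _ (by
      intro x
      rw [mem_homogeneousSubmodule, add_comm]
      exact hp.mul x.2)
  have hm : ∀ x, (m x : MvPolynomial (Fin N) L) = p * x := fun x => rfl
  let φ := (Idd I (d+1)).mkQ.comp m
  have h1 : hilbertFn L (col I p) d = Module.finrank L (LinearMap.range φ) := by
    rw [hilbertFn_eq]
    apply finrank_quot_of_ker φ.rangeRestrict φ.surjective_rangeRestrict
    intro x
    rw [← Subtype.coe_inj]
    simp only [LinearMap.codRestrict_apply, ZeroMemClass.coe_zero, φ, LinearMap.comp_apply,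
      Submodule.mkQ_apply, Submodule.Quotient.mk_eq_zero, mem_Idd, hm, mem_col, LinearMap.rangeRestrict]
  have h2 : hilbertFn L (I ⊔ Ideal.span {p}) (d+1) =
      Module.finrank L ((homogeneousSubmodule (Fin N) L (d+1) ⧸ Idd I (d+1)) ⧸ LinearMap.range φ) := by
    rw [hilbertFn_eq]
    apply finrank_quot_of_ker ((LinearMap.range φ).mkQ.comp (Idd I (d+1)).mkQ)
      ((Submodule.mkQ_surjective _).comp (Submodule.mkQ_surjective _))
    intro x
    rw [LinearMap.comp_apply, Submodule.mkQ_apply, Submodule.Quotient.mk_eq_zero, mem_Idd]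
    constructor
    · rintro ⟨y, hy⟩
      have h3 : m y - x ∈ Idd I (d+1) := by
        rw [← Submodule.Quotient.mk_eq_zero, Submodule.Quotient.mk_sub]
        rw [sub_eq_zero]; exact hy
      rw [mem_Idd] at h3
      have : (x : MvPolynomial (Fin N) L) = - ((m y - x : homogeneousSubmodule (Fin N) L (d+1)) : MvPolynomial (Fin N) L) + p * y := by
        simp [hm]
      rw [this]
      apply Ideal.add_mem
      · exact Ideal.mem_sup_left (I.neg_mem h3)
      · exact Ideal.mem_sup_right (Ideal.mul_mem_right _ _ (Ideal.mem_span_singleton_self p))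
    · intro hx
      obtain ⟨y, hy, z, hz, hyz⟩ := Submodule.mem_sup.1 hx
      obtain ⟨w, rfl⟩ := Ideal.mem_span_singleton.1 hz
      refine ⟨⟨homogeneousComponent d w, homogeneousComponent_mem d w⟩, ?_⟩
      have : m ⟨homogeneousComponent d w, homogeneousComponent_mem d w⟩ - x ∈ Idd I (d+1) := by
        rw [mem_Idd]
        have e : (x : MvPolynomial (Fin N) L) = homogeneousComponent (d+1) y + p * homogeneousComponent d w := by
          rw [← hc_mul hp, ← map_add, hyz, homogeneousComponent_of_mem x.2, if_pos rfl]
        simp only [AddSubgroupClass.coe_sub, hm]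
        rw [e]
        have := I.neg_mem (hI y hy (d+1))
        convert this using 1
        ring
      rw [← Submodule.Quotient.mk_eq_zero, Submodule.Quotient.mk_sub, sub_eq_zero] at this
      exact this
  rw [h1, h2, hilbertFn_eq]
  have := (Submodule.finrank_quotient_add_finrank (LinearMap.range φ)).symm
  rw [this]; exact Nat.add_comm _ _

theorem hilbertFn_zero_step {I : Ideal (MvPolynomial (Fin N) L)} (hI : IsGradedIdeal I)
    {p : MvPolynomial (Fin N) L} (hp : p.IsHomogeneous 1) :
    hilbertFn L I 0 = hilbertFn L (I ⊔ Ideal.span {p}) 0 := by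
  rw [hilbertFn_eq, hilbertFn_eq]
  have : Idd I 0 = Idd (I ⊔ Ideal.span {p}) 0 := by
    ext x
    rw [mem_Idd, mem_Idd]
    refine ⟨fun h => Ideal.mem_sup_left h, fun h => ?_⟩
    obtain ⟨y, hy, z, hz, hyz⟩ := Submodule.mem_sup.1 h
    obtain ⟨w, rfl⟩ := Ideal.mem_span_singleton.1 hz
    have e : (x : MvPolynomial (Fin N) L) = homogeneousComponent 0 y := by
      have := homogeneousComponent_of_mem (m := 0) x.2
      rw [if_pos rfl, ← hyz, map_add, hc_mul_lt hp (by omega), add_zero] at this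
      rw [this, hyz]
    rw [e]; exact hI y hy 0
  rw [this]

theorem hilbertFn_zero_le (I : Ideal (MvPolynomial (Fin N) L)) : hilbertFn L I 0 ≤ 1 := by
  rw [hilbertFn_eq]
  refine (Submodule.finrank_quotient_le _).trans ?_
  apply finrank_le_one (⟨1, isHomogeneous_one (Fin N) L⟩ : homogeneousSubmodule (Fin N) L 0)
  intro w
  have := w.2
  obtain ⟨c, hc⟩ := Submodule.mem_one.1 ((homogeneousSubmodule_zero (σ := Fin N) (R := L)).le this)
  refine ⟨c, ?_⟩
  ext1
  rw [← hc]
  simp [MvPolynomial.algebraMap_eq, MvPolynomial.smul_eq_C_mul]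

end HF
end EGH

namespace EGH
open Finset

/-- growth condition at one degree -/
def MacAt {n : ℕ} (a : Fin n → ℕ) (h : ℕ → ℕ) (e : ℕ) : Prop :=
  ∃ A, IsSeg a e A ∧ A.card + h e = (Bx a e).card ∧ (Sh a e A).card + h (e+1) ≤ (Bx a (e+1)).card

/-- growth condition -/
def Mac {n : ℕ} (a : Fin n → ℕ) (h : ℕ → ℕ) : Prop := ∀ e, MacAt a h e

theorem Mac.family {n : ℕ} {a : Fin n → ℕ} {h : ℕ → ℕ} (H : Mac a h) :
    ∃ A : ℕ → Finset (Fin n → ℕ), (∀ e, IsSeg a e (A e)) ∧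
      (∀ e, (A e).card + h e = (Bx a e).card) ∧ ∀ e, Sh a e (A e) ⊆ A (e+1) := by
  choose A h1 h2 h3 using H
  refine ⟨A, h1, h2, fun e => ?_⟩
  apply seg_subset (Sh_seg (h1 e)) (h1 (e+1))
  have := h2 (e+1)
  have := h3 e
  omega

theorem macAt_of {n : ℕ} {a : Fin n → ℕ} (ha : Monotone a) {h : ℕ → ℕ} {e : ℕ}
    {C : Finset (Fin n → ℕ)} (hC : C ⊆ Bx a e) (h1 : C.card + h e = (Bx a e).card)
    (h2 : (Sh a e C).card + h (e+1) ≤ (Bx a (e+1)).card) : MacAt a h e := by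
  obtain ⟨A, hA, hc⟩ := seg_exists a e C.card (Finset.card_le_card hC)
  exact ⟨A, hA, by omega, by have := CL ha hC hA hc; omega⟩

theorem mac_zero {n : ℕ} (a : Fin n → ℕ) : Mac a 0 := by
  intro e
  refine ⟨Bx a e, ⟨Finset.Subset.refl _, fun _ _ w hw _ => hw⟩, by simp, ?_⟩
  simp only [Pi.zero_apply, add_zero]
  exact Finset.card_le_card (fun v hv => (mem_Sh.1 hv).1)

theorem mem_Bx_tail {n : ℕ} {a : Fin (n+1) → ℕ} {d : ℕ} {w : Fin (n+1) → ℕ} :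
    w ∈ Bx a d ↔ Fin.tail w ∈ Bx (Fin.tail a) (d - w 0) ∧ w 0 < a 0 ∧ w 0 ≤ d := by
  rw [mem_Bx, mem_Bx, Fin.sum_univ_succ, Fin.forall_fin_succ]
  simp only [Fin.tail]
  constructor
  · rintro ⟨⟨h1, h2⟩, h3⟩; exact ⟨⟨h2, by omega⟩, h1, by omega⟩
  · rintro ⟨⟨h1, h3⟩, h2, h4⟩; exact ⟨⟨h2, h1⟩, by omega⟩

/-- glue slices -/
def Cn {n : ℕ} (a : Fin (n+1) → ℕ) (A : ℕ → ℕ → Finset (Fin n → ℕ)) (d : ℕ) :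
    Finset (Fin (n+1) → ℕ) := (Bx a d).filter (fun w => Fin.tail w ∈ A (w 0) (d - w 0))

theorem card_Cn {n : ℕ} (a : Fin (n+1) → ℕ) (A : ℕ → ℕ → Finset (Fin n → ℕ))
    (hA : ∀ i e, A i e ⊆ Bx (Fin.tail a) e) (d : ℕ) :
    (Cn a A d).card = ∑ i ∈ Finset.range (d+1), if i < a 0 then (A i (d-i)).card else 0 := by
  classical
  have hmaps : (Cn a A d : Set (Fin (n+1) → ℕ)).MapsTo (fun w => w 0) (Finset.range (d+1)) := by
    intro w hw
    rw [Finset.mem_coe, Cn, Finset.mem_filter, mem_Bx_tail] at hw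
    simp; omega
  rw [Finset.card_eq_sum_card_fiberwise hmaps]
  apply Finset.sum_congr rfl
  intro i hi
  rw [Finset.mem_range] at hi
  split_ifs with h
  · apply Finset.card_nbij Fin.tail
    · intro w hw
      rw [Finset.mem_coe, Finset.mem_filter, Cn, Finset.mem_filter] at hw
      rw [← hw.2]; exact hw.1.2
    · intro u hu w hw huw
      rw [Finset.mem_coe, Finset.mem_filter] at hu hw
      rw [← Fin.cons_self_tail u, ← Fin.cons_self_tail w, huw, hu.2, hw.2]
    · intro w hw
      refine ⟨Fin.cons i w, ?_, by simp⟩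
      rw [Finset.mem_coe, Finset.mem_filter, Cn, Finset.mem_filter, mem_Bx_tail]
      simp only [Fin.cons_zero, Fin.tail_cons]
      exact ⟨⟨⟨hA _ _ hw, h, by omega⟩, hw⟩, trivial⟩
  · rw [Finset.card_eq_zero]
    apply Finset.filter_eq_empty_iff.2
    intro w hw
    rw [Cn, Finset.mem_filter, mem_Bx_tail] at hw
    omega

theorem mac_glue {n : ℕ} {a : Fin (n+1) → ℕ} (ha : Monotone a) {h : ℕ → ℕ} {d : ℕ}
    {v : ℕ → ℕ → ℕ} (hv : ∀ i, Mac (Fin.tail a) (v i)) (hv0 : ∀ i, a 0 ≤ i → v i = 0)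
    (hs : ∀ e, h e = ∑ i ∈ Finset.range (e+1), v i (e - i))
    (hch : ∀ i ≤ d, v (i+1) (d-i) ≤ v i (d-i)) : MacAt a h d := by
  classical
  have := fun i => (hv i).family
  choose A hseg hcard hSh using this
  have hsub : ∀ i e, A i e ⊆ Bx (Fin.tail a) e := fun i e => (hseg i e).1
  have hBx : ∀ e, (Bx a e).card = ∑ i ∈ Finset.range (e+1),
      if i < a 0 then (Bx (Fin.tail a) (e-i)).card else 0 := by
    intro e
    rw [← card_Cn a (fun _ e => Bx (Fin.tail a) e) (fun _ _ => Finset.Subset.refl _)]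
    congr 1
    rw [Cn, Finset.filter_true_of_mem]
    intro w hw
    exact (mem_Bx_tail.1 hw).1
  have hcnt : ∀ e, (Cn a A e).card + h e = (Bx a e).card := by
    intro e
    rw [hBx, card_Cn a A hsub, hs, ← Finset.sum_add_distrib]
    apply Finset.sum_congr rfl
    intro i _
    split_ifs with hi
    · exact hcard i _
    · rw [hv0 i (by omega)]; rfl
  refine macAt_of ha (C := Cn a A d) (Finset.filter_subset _ _) (hcnt d) ?_
  rw [← hcnt (d+1)]
  apply Nat.add_le_add_right
  apply Finset.card_le_card
  intro w hw
  obtain ⟨hwB, u, hu, huw⟩ := mem_Sh.1 hw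
  have huw' : ∀ i, u i ≤ w i := huw
  rw [Cn, Finset.mem_filter] at hu ⊢
  refine ⟨hwB, ?_⟩
  obtain ⟨huB, huA⟩ := hu
  have huB' := mem_Bx_tail.1 huB
  have hwB' := mem_Bx_tail.1 hwB
  by_cases h0 : u 0 = w 0
  · have e : d + 1 - w 0 = (d - u 0) + 1 := by omega
    rw [e, ← h0]
    apply hSh
    rw [mem_Sh]
    refine ⟨?_, _, huA, fun i => huw' i.succ⟩
    rw [← e]; exact hwB'.1
  · have hinc := eq_inc huB hwB huw 0 h0
    have hw0 : w 0 = u 0 + 1 := by rw [hinc]; simp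
    have ht : Fin.tail w = Fin.tail u := by
      rw [hinc]; exact Fin.tail_update_zero _ _
    have e : d + 1 - w 0 = d - u 0 := by omega
    rw [ht, e, hw0]
    apply seg_subset (hseg (u 0) _) (hseg (u 0 + 1) _) _ huA
    have h1 := hcard (u 0) (d - u 0)
    have h2 := hcard (u 0 + 1) (d - u 0)
    have h3 := hch (u 0) (by omega)
    omega

section
variable {N : ℕ} {L : Type*} [Field L]

theorem greedy (k : ℕ) : ∀ (g : List (MvPolynomial (Fin N) L)), g.length = k →
    (∀ p ∈ g, p.IsHomogeneous 1) → ∀ (I : Ideal (MvPolynomial (Fin N) L)), IsGradedIdeal I →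
    g.prod ∈ I → ∀ d : ℕ, ∃ v : ℕ → ℕ → ℕ,
    (∀ i, v i = 0 ∨ ∃ p ∈ g, ∃ I', I ≤ I' ∧ IsGradedIdeal I' ∧ p ∈ I' ∧ v i = hilbertFn L I') ∧
    (∀ i, g.length ≤ i → v i = 0) ∧
    (∀ e, hilbertFn L I e = ∑ i ∈ Finset.range (e+1), v i (e - i)) ∧
    (∀ i ≤ d, v (i+1) (d-i) ≤ v i (d-i)) ∧
    (v 0 = 0 ∨ ∃ p ∈ g, v 0 = hilbertFn L (I ⊔ Ideal.span {p})) := by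
  classical
  induction k with
  | zero =>
    intro g hg _ I _ hI d
    have : g = [] := List.length_eq_zero_iff.1 hg
    subst this
    have hT : I = ⊤ := (Ideal.eq_top_iff_one I).2 (by simpa using hI)
    subst hT
    refine ⟨0, by simp, by simp, ?_, by simp, by simp⟩
    intro e; rw [hilbertFn_top]; simp
  | succ k ih =>
    intro g hg hlin I hI hprod d
    have hne : g.toFinset.Nonempty := by
      rw [List.toFinset_nonempty_iff]
      rintro rfl; simp at hg
    obtain ⟨p, hp, hmax⟩ := Finset.exists_max_image g.toFinset
      (fun p => hilbertFn L (I ⊔ Ideal.span {p}) d) hne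
    rw [List.mem_toFinset] at hp
    have hperm := List.perm_cons_erase hp
    have hplin := hlin p hp
    obtain ⟨v', w1, w2, w3, w4, w5⟩ := ih (g.erase p) (by
        rw [List.length_erase_of_mem hp, hg]; rfl)
      (fun q hq => hlin q (List.mem_of_mem_erase hq)) (col I p) (col_graded hI hplin) (by
        rw [mem_col, ← List.prod_cons, ← hperm.prod_eq]; exact hprod) (d-1)
    refine ⟨fun i => Nat.casesOn i (hilbertFn L (I ⊔ Ideal.span {p})) v', ?_, ?_, ?_, ?_, ?_⟩
    · rintro (_ | i)
      · right
        exact ⟨p, hp, _, le_sup_left, sup_graded hI hplin,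
          Ideal.mem_sup_right (Ideal.mem_span_singleton_self p), rfl⟩
      · rcases w1 i with h | ⟨q, hq, I', h1, h2, h3, h4⟩
        · exact Or.inl h
        · exact Or.inr ⟨q, List.mem_of_mem_erase hq, I', (le_col I p).trans h1, h2, h3, h4⟩
    · rintro (_ | i) hi
      · omega
      · apply w2
        rw [List.length_erase_of_mem hp]; omega
    · rintro (_ | e)
      · simpa using hilbertFn_zero_step hI hplin
      · rw [hilbertFn_step hI hplin, Finset.sum_range_succ', w3 e]
        simp
    · rintro (_ | i) hi
      · show v' 0 (d - 0) ≤ hilbertFn L (I ⊔ Ideal.span {p}) (d - 0)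
        rw [Nat.sub_zero]
        rcases w5 with h | ⟨q, hq, h⟩
        · rw [h]; simp
        · rw [h]
          refine le_trans (hilbertFn_mono ?_ d) (hmax q (List.mem_toFinset.2 (List.mem_of_mem_erase hq)))
          exact sup_le_sup_right (le_col I p) _
      · have := w4 i (by omega)
        have e : d - 1 - i = d - (i+1) := by omega
        rw [e] at this
        exact this
    · right
      exact ⟨p, hp, rfl⟩

/-- the rank condition -/
def Cond (G : Set (List (MvPolynomial (Fin N) L))) {n : ℕ} (a : Fin n → ℕ)
    (U : Submodule L (MvPolynomial (Fin N) L)) : Prop :=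
  ∀ i : Fin n, ∀ W : Submodule L (MvPolynomial (Fin N) L), W ≤ homogeneousSubmodule (Fin N) L 1 →
    U ≤ W → (∀ g ∈ G, g.length ≤ a i → ∃ p ∈ g, p ∈ W) →
    (i : ℕ) + 1 + Module.finrank L U ≤ Module.finrank L W

theorem homog_mem_of_X {I : Ideal (MvPolynomial (Fin N) L)} (h : ∀ i, (X i : MvPolynomial (Fin N) L) ∈ I)
    {e : ℕ} (he : e ≠ 0) {x : MvPolynomial (Fin N) L} (hx : x.IsHomogeneous e) : x ∈ I := by
  have : x ∈ Ideal.span ((X : Fin N → MvPolynomial (Fin N) L) '' Set.univ) := by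
    rw [mem_ideal_span_X_image]
    intro m hm
    by_contra! hcon
    have hd := hx.degree_eq_sum_deg_support hm
    have : m = 0 := by ext i; exact hcon i (Set.mem_univ i)
    rw [this] at hd
    simp at hd; omega
  refine (Ideal.span_le.2 ?_) this
  rintro _ ⟨i, _, rfl⟩
  exact h i

theorem finrank_hom_one : Module.finrank L (homogeneousSubmodule (Fin N) L 1) = N := by
  rw [homogeneousSubmodule_one_eq_span_X, finrank_span_eq_card]
  · simp
  · exact MvPolynomial.linearIndependent_X (Fin N) L

theorem fd_of_le {U : Submodule L (MvPolynomial (Fin N) L)}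
    (hU : U ≤ homogeneousSubmodule (Fin N) L 1) : FiniteDimensional L U :=
  Submodule.finiteDimensional_of_le hU

theorem finrank_sup_span {U : Submodule L (MvPolynomial (Fin N) L)}
    (hU : U ≤ homogeneousSubmodule (Fin N) L 1) {p : MvPolynomial (Fin N) L}
    (hp : p.IsHomogeneous 1) (hpU : p ∉ U) :
    Module.finrank L (U ⊔ Submodule.span L {p} : Submodule L (MvPolynomial (Fin N) L)) =
      Module.finrank L U + 1 := by
  have hle : U ⊔ Submodule.span L {p} ≤ homogeneousSubmodule (Fin N) L 1 :=
    sup_le hU (by rw [Submodule.span_singleton_le_iff_mem]; exact hp)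
  have := fd_of_le hU
  have := fd_of_le hle
  have h1 : U < U ⊔ Submodule.span L {p} := by
    refine lt_of_le_of_ne le_sup_left (fun h => hpU ?_)
    rw [h]; exact Submodule.mem_sup_right (Submodule.mem_span_singleton_self p)
  have h2 := Submodule.finrank_lt_finrank_of_lt h1
  have h3 := Submodule.finrank_add_le_finrank_add_finrank U (Submodule.span L {p})
  have h4 : Module.finrank L (Submodule.span L {p}) = 1 := finrank_span_singleton (K := L) (fun h => hpU (h ▸ U.zero_mem))
  omega

theorem egh_step (G : Set (List (MvPolynomial (Fin N) L))) (hG : ∀ g ∈ G, ∀ p ∈ g, p.IsHomogeneous 1)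
    (n : ℕ) : ∀ (a : Fin n → ℕ), Monotone a → ∀ U : Submodule L (MvPolynomial (Fin N) L),
    U ≤ homogeneousSubmodule (Fin N) L 1 → N ≤ Module.finrank L U + n → Cond G a U →
    ∀ I : Ideal (MvPolynomial (Fin N) L), IsGradedIdeal I → (∀ u ∈ U, u ∈ I) →
    (∀ g ∈ G, g.prod ∈ I) → Mac a (hilbertFn L I) := by
  induction n with
  | zero =>
    intro a _ U hU hN _ I _ hUI _
    have hUV : U = homogeneousSubmodule (Fin N) L 1 := by
      apply Submodule.eq_of_le_of_finrank_le hU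
      rw [finrank_hom_one]; omega
    have hz : ∀ e, e ≠ 0 → hilbertFn L I e = 0 := by
      intro e he
      apply hilbertFn_eq_zero_of
      intro x hx
      refine homog_mem_of_X (fun i => hUI _ ?_) he hx
      rw [hUV]; exact isHomogeneous_X L i
    have hB : ∀ e, hilbertFn L I e ≤ (Bx a e).card := by
      intro e
      by_cases he : e = 0
      · subst he
        refine (hilbertFn_zero_le I).trans ?_
        rw [Nat.succ_le_iff, Finset.card_pos]
        exact ⟨fun _ => 0, mem_Bx.2 ⟨fun i => i.elim0, by simp⟩⟩
      · rw [hz e he]; omega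
    intro e
    obtain ⟨A, hA, hc⟩ := seg_exists a e ((Bx a e).card - hilbertFn L I e) (by omega)
    refine ⟨A, hA, by have := hB e; omega, ?_⟩
    rw [hz (e+1) (by omega), add_zero]
    exact Finset.card_le_card (fun v hv => (mem_Sh.1 hv).1)
  | succ n ih =>
    intro a ha U hU hN hcond I hI hUI hGI
    have hex : ∃ g ∈ G, g.length ≤ a 0 ∧ ∀ p ∈ g, p ∉ U := by
      by_contra! hcon
      have := hcond 0 U hU le_rfl hcon
      simp at this
    obtain ⟨g, hgG, hgl, hgU⟩ := hex
    have ha' : Monotone (Fin.tail a) := fun i j hij => ha (by simpa using hij)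
    intro d
    obtain ⟨v, w1, w2, w3, w4, _⟩ := greedy g.length g rfl (hG g hgG) I hI (hGI g hgG) d
    refine mac_glue ha (fun i => ?_) (fun i hi => w2 i (by omega)) w3 w4
    rcases w1 i with h | ⟨p, hp, I', hII', hI', hpI', h⟩
    · rw [h]; exact mac_zero _
    · rw [h]
      have hplin := hG g hgG p hp
      have hfr := finrank_sup_span hU hplin (hgU p hp)
      refine ih (Fin.tail a) ha' (U ⊔ Submodule.span L {p})
        (sup_le hU (by rw [Submodule.span_singleton_le_iff_mem]; exact hplin)) (by omega) ?_ I' hI' ?_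
        (fun g hg => hII' (hGI g hg))
      · intro i W hW hUW hWg
        have := hcond i.succ W hW (le_sup_left.trans hUW) hWg
        rw [hfr]
        simp at this
        omega
      · have : U ⊔ Submodule.span L {p} ≤ Submodule.restrictScalars L I' := by
          refine sup_le (fun u hu => hII' (hUI u hu)) ?_
          rw [Submodule.span_singleton_le_iff_mem]; exact hpI'
        exact fun u hu => this hu

end
end EGH

namespace EGH
open Finset

section WR
variable {R : Type*} [CommRing R]

/-- Elementary form of weakly regular sequences on `R/I`. -/
def WR (I : Ideal R) : List R → Prop
  | [] => True
  | r :: rs => (∀ x, r * x ∈ I → x ∈ I) ∧ WR (I ⊔ Ideal.span {r}) rs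

theorem WR_iff (I : Ideal R) (rs : List R) : WR I rs ↔
    ∀ i (h : i < rs.length) x, rs[i] * x ∈ I ⊔ Ideal.ofList (rs.take i) →
      x ∈ I ⊔ Ideal.ofList (rs.take i) := by
  induction rs generalizing I with
  | nil => simp [WR]
  | cons r rs ih =>
    rw [WR, ih]
    constructor
    · rintro ⟨h0, h1⟩ i hi x hx
      cases i with
      | zero => simpa using h0 x (by simpa using hx)
      | succ j =>
        have := h1 j (by simpa using hi) x
        simp only [List.take_succ_cons, Ideal.ofList_cons, ← sup_assoc] at hx ⊢
        exact this (by simpa using hx)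
    · intro h
      refine ⟨fun x hx => ?_, fun i hi x hx => ?_⟩
      · simpa using h 0 (by simp) x (by simpa using hx)
      · have := h (i+1) (by simpa using hi) x
        simp only [List.take_succ_cons, Ideal.ofList_cons, ← sup_assoc] at this
        exact this (by simpa using hx)

theorem WR_append (I : Ideal R) (rs ss : List R) :
    WR I (rs ++ ss) ↔ WR I rs ∧ WR (I ⊔ Ideal.ofList rs) ss := by
  induction rs generalizing I with
  | nil => simp [WR]
  | cons r rs ih =>
    simp only [List.cons_append, WR, ih, Ideal.ofList_cons, sup_assoc, and_assoc]

theorem WR_take {I : Ideal R} {rs : List R} (h : WR I rs) (k : ℕ) : WR I (rs.take k) := by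
  rw [← List.take_append_drop k rs, WR_append] at h
  exact h.1

theorem isWeaklyRegular_iff_WR (rs : List R) :
    RingTheory.Sequence.IsWeaklyRegular R rs ↔ WR ⊥ rs := by
  rw [WR_iff, RingTheory.Sequence.isWeaklyRegular_iff]
  refine forall_congr' fun i => forall_congr' fun h => ?_
  rw [isSMulRegular_quotient_iff_mem_of_smul_mem]
  simp

theorem WR_map {A : Type*} [CommRing A] (f : R →+* A) (hf : Function.Surjective f)
    (J : Ideal A) (rs : List R) : WR J (rs.map f) ↔ WR (J.comap f) rs := by
  induction rs generalizing J with
  | nil => simp [WR]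
  | cons r rs ih =>
    have e : (J ⊔ Ideal.span {f r}).comap f = J.comap f ⊔ Ideal.span {r} := by
      have : J ⊔ Ideal.span {f r} = Ideal.map f (J.comap f ⊔ Ideal.span {r}) := by
        rw [Ideal.map_sup, Ideal.map_comap_of_surjective f hf, Ideal.map_span, Set.image_singleton]
      rw [this, Ideal.comap_map_of_surjective f hf, sup_eq_left]
      exact le_trans (Ideal.comap_mono bot_le) le_sup_left
    simp only [List.map_cons, WR, ih, e]
    refine and_congr_left fun _ => ?_
    constructor
    · intro h x hx
      exact h (f x) (by simpa using hx)
    · intro h x hx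
      obtain ⟨y, rfl⟩ := hf x
      exact h y (by simpa using hx)

theorem exists_lift_list {A : Type*} (f : R → A) (P : R → Prop) (rs : List A)
    (h : ∀ x ∈ rs, ∃ y, P y ∧ f y = x) : ∃ ss : List R, (∀ y ∈ ss, P y) ∧ ss.map f = rs := by
  induction rs with
  | nil => exact ⟨[], by simp, by simp⟩
  | cons x rs ih =>
    obtain ⟨ss, h1, h2⟩ := ih fun y hy => h y (by simp [hy])
    obtain ⟨y, hy, e⟩ := h x (by simp)
    exact ⟨y :: ss, by simpa [hy] using h1, by simp [h2, e]⟩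

theorem WR_height (rs : List R) (I : Ideal R) (h : WR I rs) (P : Ideal R) [P.IsPrime]
    (hP : I ⊔ Ideal.ofList rs ≤ P) :
    ∃ P0 : Ideal R, P0.IsPrime ∧ I ≤ P0 ∧ P0 ≤ P ∧ P0.height + rs.length ≤ P.height := by
  induction rs generalizing I with
  | nil => exact ⟨P, inferInstance, le_trans le_sup_left hP, le_rfl, by simp⟩
  | cons r rs ih =>
    obtain ⟨P1, hp1, h1, h2, h3⟩ := ih (I ⊔ Ideal.span {r}) h.2
      (by simpa [Ideal.ofList_cons, sup_assoc] using hP)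
    obtain ⟨P0, hP0, hle⟩ := Ideal.exists_minimalPrimes_le (le_trans le_sup_left h1)
    have hprime : P0.IsPrime := hP0.1.1
    have hr1 : r ∈ P1 := h1 (Ideal.mem_sup_right (Ideal.mem_span_singleton_self r))
    have hr0 : r ∉ P0 := by
      intro hr
      obtain ⟨y, hy, hyr⟩ := Ideal.exists_mul_mem_of_mem_minimalPrimes hP0 hr
      exact hy (h.1 y hyr)
    have hlt : P0 < P1 := lt_of_le_of_ne hle fun e => hr0 (e ▸ hr1)
    have := Ideal.height_add_one_le_of_lt_of_isPrime hlt
    refine ⟨P0, hprime, hP0.1.2, hle.trans h2, le_trans ?_ h3⟩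
    rw [List.length_cons, Nat.cast_add, Nat.cast_one, add_comm (rs.length : ℕ∞), ← add_assoc]
    gcongr

/-- Swap. -/
theorem WR_swap (rs : List R) (I : Ideal R) (l : R) (h : WR I rs)
    (hl : ∀ j < rs.length, ∀ x, l * x ∈ I ⊔ Ideal.ofList (rs.take j) → x ∈ I ⊔ Ideal.ofList (rs.take j)) :
    WR (I ⊔ Ideal.span {l}) (rs.take (rs.length - 1)) := by
  induction rs generalizing I with
  | nil => simp [WR]
  | cons r rs ih =>
    cases rs with
    | nil => simp [WR]
    | cons s rs =>
      simp only [List.length_cons, Nat.add_sub_cancel, List.take_succ_cons, WR]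
      have hl1 : ∀ x, l * x ∈ I ⊔ Ideal.span {r} → x ∈ I ⊔ Ideal.span {r} := by
        intro x hx
        simpa using hl 1 (by simp) x (by simpa using hx)
      constructor
      · intro x hx
        obtain ⟨i, hi, y, hy, e⟩ := Submodule.mem_sup.1 hx
        obtain ⟨z, rfl⟩ := Ideal.mem_span_singleton.1 hy
        have hz : l * z ∈ I ⊔ Ideal.span {r} := by
          have : l * z = r * x - i := by rw [← e]; ring
          rw [this]
          exact sub_mem (Ideal.mem_sup_right (Ideal.mul_mem_right _ _ (Ideal.mem_span_singleton_self r)))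
            (Ideal.mem_sup_left hi)
        obtain ⟨i', hi', y', hy', e'⟩ := Submodule.mem_sup.1 (hl1 z hz)
        obtain ⟨z', rfl⟩ := Ideal.mem_span_singleton.1 hy'
        have : x - l * z' ∈ I := by
          apply h.1
          have : r * (x - l * z') = i + l * i' := by
            rw [mul_sub, ← e, ← e']; ring
          rw [this]
          exact add_mem hi (Ideal.mul_mem_left _ _ hi')
        have e2 : x = (x - l * z') + l * z' := by ring
        rw [e2]
        exact add_mem (Ideal.mem_sup_left this)
          (Ideal.mem_sup_right (Ideal.mul_mem_right _ _ (Ideal.mem_span_singleton_self l)))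
      · rw [sup_right_comm]
        have := ih (I ⊔ Ideal.span {r}) h.2 ?_
        · simpa using this
        · intro j hj x hx
          have := hl (j+1) (by simpa using hj) x
          simp only [List.take_succ_cons, Ideal.ofList_cons, ← sup_assoc] at this
          exact this hx

end WR
end EGH

namespace EGH
open Finset

section Lin
variable {N : ℕ} {L : Type*} [Field L]

theorem lin_aux (W : Submodule L (MvPolynomial (Fin N) L))
    (hW : W ≤ homogeneousSubmodule (Fin N) L 1) :
    ∃ φ : MvPolynomial (Fin N) L →ₐ[L] MvPolynomial (Fin N) L,
      RingHom.ker φ = Ideal.span (W : Set (MvPolynomial (Fin N) L)) ∧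
      ∀ p ∈ homogeneousSubmodule (Fin N) L 1, φ p = 0 → p ∈ W := by
  obtain ⟨g, hg⟩ := LinearMap.exists_leftInverse_of_injective W.subtype (by simp)
  let π : MvPolynomial (Fin N) L →ₗ[L] MvPolynomial (Fin N) L :=
    LinearMap.id - W.subtype.comp g
  have hπ : ∀ p, π p = p - (g p : MvPolynomial (Fin N) L) := fun p => rfl
  let φ : MvPolynomial (Fin N) L →ₐ[L] MvPolynomial (Fin N) L := aeval fun i => π (X i)
  have hφ : ∀ p ∈ homogeneousSubmodule (Fin N) L 1, φ p = π p := by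
    intro p hp
    rw [homogeneousSubmodule_one_eq_span_X] at hp
    induction hp using Submodule.span_induction with
    | mem x h => obtain ⟨i, rfl⟩ := h; simp [φ]
    | zero => simp
    | add x y _ _ hx hy => rw [map_add, map_add, hx, hy]
    | smul a x _ hx => rw [map_smul, map_smul, hx]
  have hkill : ∀ w ∈ W, φ w = 0 := by
    intro w hw
    rw [hφ w (hW hw), hπ]
    have := LinearMap.congr_fun hg ⟨w, hw⟩
    simp at this
    simp [this]
  have hdiff : ∀ p, p - φ p ∈ Ideal.span (W : Set (MvPolynomial (Fin N) L)) := by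
    intro p
    induction p using MvPolynomial.induction_on with
    | C a => simp [φ]
    | add p q hp hq =>
      have : p + q - φ (p + q) = (p - φ p) + (q - φ q) := by rw [map_add]; ring
      rw [this]; exact add_mem hp hq
    | mul_X p i hp =>
      have h1 : X i - φ (X i) ∈ Ideal.span (W : Set (MvPolynomial (Fin N) L)) := by
        have : X i - φ (X i) = (g (X i) : MvPolynomial (Fin N) L) := by
          simp [φ, hπ]
        rw [this]
        exact Ideal.subset_span (g (X i)).2
      have : p * X i - φ (p * X i) = (p - φ p) * X i + φ p * (X i - φ (X i)) := by
        rw [map_mul]; ring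
      rw [this]
      exact add_mem (Ideal.mul_mem_right _ _ hp) (Ideal.mul_mem_left _ _ h1)
  refine ⟨φ, le_antisymm ?_ ?_, ?_⟩
  · intro p hp
    have h := hdiff p
    rw [RingHom.mem_ker] at hp
    rwa [show φ p = 0 from hp, sub_zero] at h
  · rw [Ideal.span_le]
    intro w hw
    exact hkill w hw
  · intro p hp h
    rw [hφ p hp, hπ, sub_eq_zero] at h
    rw [h]; exact (g p).2

theorem lin_prime {W : Submodule L (MvPolynomial (Fin N) L)}
    (hW : W ≤ homogeneousSubmodule (Fin N) L 1) :
    (Ideal.span (W : Set (MvPolynomial (Fin N) L))).IsPrime := by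
  obtain ⟨φ, h, -⟩ := lin_aux W hW
  rw [← h]
  exact RingHom.ker_isPrime _

theorem lin_mem {W : Submodule L (MvPolynomial (Fin N) L)}
    (hW : W ≤ homogeneousSubmodule (Fin N) L 1) {p : MvPolynomial (Fin N) L}
    (hp : p.IsHomogeneous 1) (h : p ∈ Ideal.span (W : Set (MvPolynomial (Fin N) L))) : p ∈ W := by
  obtain ⟨φ, h1, h2⟩ := lin_aux W hW
  rw [← h1] at h
  exact h2 p hp h

theorem lin_gens {W : Submodule L (MvPolynomial (Fin N) L)}
    (hW : W ≤ homogeneousSubmodule (Fin N) L 1) :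
    ∃ s : Finset (MvPolynomial (Fin N) L), s.card ≤ Module.finrank L W ∧
      Ideal.span (s : Set (MvPolynomial (Fin N) L)) =
        Ideal.span (W : Set (MvPolynomial (Fin N) L)) := by
  classical
  have := fd_of_le hW
  let b := Module.finBasis L W
  refine ⟨Finset.univ.image fun i => (b i : MvPolynomial (Fin N) L), ?_, ?_⟩
  · exact Finset.card_image_le.trans (by simp)
  · apply le_antisymm
    · apply Ideal.span_mono
      intro x hx
      simp at hx
      obtain ⟨i, rfl⟩ := hx
      exact (b i).2
    · rw [Ideal.span_le]
      intro w hw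
      have e := b.sum_repr ⟨w, hw⟩
      have e2 : w = ∑ i, (b.repr ⟨w, hw⟩) i • (b i : MvPolynomial (Fin N) L) := by
        have := congrArg W.subtype e
        rw [map_sum] at this
        simp only [map_smul, Submodule.subtype_apply] at this
        exact this.symm
      rw [e2]
      refine sum_mem fun i _ => ?_
      rw [smul_eq_C_mul]
      exact Ideal.mul_mem_left _ _ (Ideal.subset_span (by simp))

theorem lin_height_le {W : Submodule L (MvPolynomial (Fin N) L)}
    (hW : W ≤ homogeneousSubmodule (Fin N) L 1) :
    (Ideal.span (W : Set (MvPolynomial (Fin N) L))).height ≤ Module.finrank L W := by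
  obtain ⟨s, hs, e⟩ := lin_gens hW
  have := lin_prime hW
  refine (Ideal.height_le_card_of_mem_minimalPrimes_span_finset (s := s) ?_).trans
    (by exact_mod_cast hs)
  rw [e]
  exact ⟨⟨this, le_rfl⟩, fun q hq _ => hq.2⟩

theorem le_lin_height_aux {D : ℕ} (v : Fin D → MvPolynomial (Fin N) L) (hv : LinearIndependent L v)
    (W : Submodule L (MvPolynomial (Fin N) L))
    (hW : W ≤ homogeneousSubmodule (Fin N) L 1) (hvW : ∀ i, v i ∈ W) :
    (D : ℕ∞) ≤ (Ideal.span (W : Set (MvPolynomial (Fin N) L))).height := by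
  let Wk : ℕ → Submodule L (MvPolynomial (Fin N) L) := fun k =>
    Submodule.span L (v '' {i | i.val < k})
  have hk : ∀ k, Wk k ≤ homogeneousSubmodule (Fin N) L 1 := by
    intro k
    rw [Submodule.span_le]
    rintro _ ⟨i, -, rfl⟩
    exact hW (hvW i)
  have key : ∀ k ≤ D, (k : ℕ∞) ≤ (Ideal.span (Wk k : Set (MvPolynomial (Fin N) L))).height := by
    intro k
    induction k with
    | zero => simp
    | succ k ih =>
      intro hkN
      have h1 := ih (by omega)
      have := lin_prime (hk k)
      have := lin_prime (hk (k+1))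
      have hlt : Ideal.span (Wk k : Set (MvPolynomial (Fin N) L)) <
          Ideal.span (Wk (k+1) : Set (MvPolynomial (Fin N) L)) := by
        refine lt_of_le_of_ne (Ideal.span_mono (Submodule.span_mono (Set.image_mono ?_))) ?_
        · intro i (hi : i.val < k)
          show i.val < k + 1
          omega
        · intro e
          have hm : v ⟨k, by omega⟩ ∈ Ideal.span (Wk k : Set (MvPolynomial (Fin N) L)) := by
            rw [e]
            refine Ideal.subset_span (Submodule.subset_span ⟨_, ?_, rfl⟩)
            show k < k + 1
            omega
          have := lin_mem (hk k) (hW (hvW _)) hm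
          refine LinearIndependent.notMem_span_image hv
            (s := {i | i.val < k}) ?_ this
          show ¬ k < k
          omega
      have := Ideal.height_add_one_le_of_lt_of_isPrime hlt
      refine le_trans ?_ this
      push_cast
      gcongr
  refine (key D le_rfl).trans (Ideal.height_mono (Ideal.span_mono ?_))
  refine Submodule.span_le.2 ?_
  rintro _ ⟨i, -, rfl⟩
  exact hvW i

theorem le_lin_height {W : Submodule L (MvPolynomial (Fin N) L)}
    (hW : W ≤ homogeneousSubmodule (Fin N) L 1) :
    (Module.finrank L W : ℕ∞) ≤ (Ideal.span (W : Set (MvPolynomial (Fin N) L))).height := by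
  have := fd_of_le hW
  let b := Module.finBasis L W
  refine le_lin_height_aux (fun i => (b i : MvPolynomial (Fin N) L)) ?_ W hW fun i => (b i).2
  exact b.linearIndependent.map' W.subtype (by simp)

theorem m_height : (N : ℕ∞) ≤ (Ideal.span
    ((homogeneousSubmodule (Fin N) L 1 : Submodule L _) : Set (MvPolynomial (Fin N) L))).height := by
  have := le_lin_height (N := N) (L := L) le_rfl
  rwa [finrank_hom_one] at this

theorem lin_dim {W : Submodule L (MvPolynomial (Fin N) L)}
    (hW : W ≤ homogeneousSubmodule (Fin N) L 1) :
    (N : WithBot ℕ∞) ≤ ringKrullDim (MvPolynomial (Fin N) L ⧸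
      Ideal.span (W : Set (MvPolynomial (Fin N) L))) + Module.finrank L W := by
  obtain ⟨s, hs, e⟩ := lin_gens hW
  have := lin_prime (N := N) (L := L) le_rfl
  have h := Ideal.height_le_ringKrullDim_quotient_add_encard (p := Ideal.span
    ((homogeneousSubmodule (Fin N) L 1 : Submodule L _) : Set (MvPolynomial (Fin N) L)))
    (s : Set (MvPolynomial (Fin N) L)) ?_
  · rw [e] at h
    refine le_trans ?_ (h.trans ?_)
    · exact_mod_cast m_height (N := N) (L := L)
    · gcongr
      rw [Set.encard_coe_eq_coe_finsetCard]
      exact_mod_cast hs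
  · refine Set.Subset.trans Ideal.subset_span ?_
    rw [e]
    exact Ideal.span_mono hW

theorem cm_seq {n t : ℕ} (K : Type*) [Field K]
    (M : Ideal (MvPolynomial (Fin n) K)) (hred : TotallyReducible M)
    (f : Fin t → MvPolynomial (Fin n) K)
    (hfM : ∀ i, f i ∈ M)
    (hfreg : RingTheory.Sequence.IsRegular (MvPolynomial (Fin n) K) (List.ofFn f))
    (I : Ideal (MvPolynomial (Fin n) K)) (hMI : M ≤ I)
    (hht : idealHeight I = t) (hCM : QuotientIsCM I) :
    ∃ rs : List (MvPolynomial (Fin n) K), rs.length = n - t ∧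
      (∀ y ∈ rs, y ∈ Ideal.span (Set.range (X : Fin n → MvPolynomial (Fin n) K))) ∧
      WR I rs ∧ I ≠ ⊤ := by
  obtain ⟨rs0, hm, hreg, hlen⟩ := hCM
  obtain ⟨rs, hrs, rfl⟩ := exists_lift_list (Ideal.Quotient.mk I)
    (fun y => y ∈ Ideal.span (Set.range (X : Fin n → MvPolynomial (Fin n) K))) rs0 (by
      intro x hx
      obtain ⟨y, hy, e⟩ := (Ideal.mem_map_iff_of_surjective _ Ideal.Quotient.mk_surjective).1 (hm x hx)
      exact ⟨y, hy, e⟩)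
  have hWR : WR I rs := by
    have := (isWeaklyRegular_iff_WR _).1 hreg.toIsWeaklyRegular
    rw [WR_map _ Ideal.Quotient.mk_surjective, ← RingHom.ker_eq_comap_bot, Ideal.mk_ker] at this
    exact this
  have hne : {h : ℕ∞ | ∃ p : PrimeSpectrum (MvPolynomial (Fin n) K), I ≤ p.asIdeal ∧ h = Order.height p}.Nonempty := by
    by_contra hcon
    rw [Set.not_nonempty_iff_eq_empty] at hcon
    rw [idealHeight, hcon, sInf_empty] at hht
    exact absurd hht (by simp)
  obtain ⟨P, hIP, hPt⟩ := csInf_mem hne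
  have hPt' : P.asIdeal.height = t := by
    rw [PrimeSpectrum.height_eq_orderHeight, ← hPt]; exact hht
  have hIne : I ≠ ⊤ := fun e => P.isPrime.ne_top (top_le_iff.1 (e ▸ hIP))
  let W : Submodule K (MvPolynomial (Fin n) K) :=
    Submodule.restrictScalars K P.asIdeal ⊓ homogeneousSubmodule (Fin n) K 1
  have hW : W ≤ homogeneousSubmodule (Fin n) K 1 := inf_le_right
  have hWP : Ideal.span (W : Set (MvPolynomial (Fin n) K)) ≤ P.asIdeal :=
    Ideal.span_le.2 fun w hw => hw.1
  have hMW : M ≤ Ideal.span (W : Set (MvPolynomial (Fin n) K)) := by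
    obtain ⟨G, hG, hG2⟩ := hred
    rw [hG, Ideal.span_le]
    intro g hg
    obtain ⟨k, l, hl, rfl⟩ := hG2 g hg
    have h1 : ∏ i, l i ∈ P.asIdeal := hIP (hMI (hG ▸ Ideal.subset_span hg))
    obtain ⟨i, -, hi⟩ := (Ideal.IsPrime.prod_mem_iff (hp := P.isPrime)).1 h1
    exact Ideal.prod_mem (I := Ideal.span (W : Set (MvPolynomial (Fin n) K)))
      (Finset.mem_univ i) (Ideal.subset_span ⟨hi, hl i⟩)
  have hpr := lin_prime hW
  have htW : (t : ℕ∞) ≤ (Ideal.span (W : Set (MvPolynomial (Fin n) K))).height := by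
    obtain ⟨P0, -, -, -, h⟩ := WR_height (List.ofFn f) ⊥
      ((isWeaklyRegular_iff_WR _).1 hfreg.toIsWeaklyRegular)
      (Ideal.span (W : Set (MvPolynomial (Fin n) K))) (by
        rw [bot_sup_eq, Ideal.span_le]
        intro x (hx : x ∈ List.ofFn f)
        rw [List.mem_ofFn] at hx
        obtain ⟨i, rfl⟩ := hx
        exact hMW (hfM i))
    rw [List.length_ofFn] at h
    exact le_trans (by simp) h
  have heq : Ideal.span (W : Set (MvPolynomial (Fin n) K)) = P.asIdeal :=
    Ideal.eq_of_le_of_height_le _ hWP (by rw [hPt']; exact htW)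
  have hfr : Module.finrank K W ≤ t := by
    have := le_lin_height hW
    rw [heq, hPt'] at this
    exact_mod_cast this
  have hd := lin_dim hW
  have hd2 : ringKrullDim (MvPolynomial (Fin n) K ⧸ Ideal.span (W : Set (MvPolynomial (Fin n) K))) ≤
      ringKrullDim (MvPolynomial (Fin n) K ⧸ I) :=
    ringKrullDim_le_of_surjective (Ideal.Quotient.factor (heq ▸ hIP))
      (Ideal.Quotient.factor_surjective _)
  rw [← hlen] at hd2
  have hd3 : (n : WithBot ℕ∞) ≤ ((rs.length + t : ℕ) : WithBot ℕ∞) := by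
    refine hd.trans ?_
    push_cast
    refine add_le_add ?_ (by exact_mod_cast hfr)
    simpa using hd2
  have hd4 : n ≤ rs.length + t := by exact_mod_cast hd3
  refine ⟨rs.take (n - t), ?_, fun y hy => hrs y (List.mem_of_mem_take hy), WR_take hWR _, hIne⟩
  rw [List.length_take]; omega

end Lin
end EGH

namespace EGH
open Finset

section BC
variable {N : ℕ} {K L : Type*} [Field K] [Field L] [Algebra K L]

/-- apply a functional coefficientwise -/
noncomputable def cw (l : L →ₗ[K] K) (F : MvPolynomial (Fin N) L) : MvPolynomial (Fin N) K :=
  ∑ m ∈ F.support, monomial m (l (coeff m F))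

theorem coeff_cw (l : L →ₗ[K] K) (F : MvPolynomial (Fin N) L) (m : Fin N →₀ ℕ) :
    coeff m (cw l F) = l (coeff m F) := by
  classical
  rw [cw, coeff_sum]
  simp only [coeff_monomial]
  rw [Finset.sum_ite_eq' F.support m]
  split_ifs with h
  · rfl
  · rw [notMem_support_iff] at h
    rw [h, map_zero]

theorem cw_add (l : L →ₗ[K] K) (F G : MvPolynomial (Fin N) L) : cw l (F + G) = cw l F + cw l G := by
  ext m; simp [coeff_cw]

theorem cw_zero (l : L →ₗ[K] K) : cw l (0 : MvPolynomial (Fin N) L) = 0 := by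
  ext m; simp [coeff_cw]

theorem cw_mul (l : L →ₗ[K] K) (p : MvPolynomial (Fin N) K) (F : MvPolynomial (Fin N) L) :
    cw l (map (algebraMap K L) p * F) = p * cw l F := by
  classical
  ext m
  rw [coeff_cw, coeff_mul, coeff_mul, map_sum]
  refine Finset.sum_congr rfl fun x _ => ?_
  rw [coeff_map, coeff_cw, ← Algebra.smul_def, map_smul, smul_eq_mul]

theorem cw_sum {ι : Type*} (s : Finset ι) (l : L →ₗ[K] K) (F : ι → MvPolynomial (Fin N) L) :
    cw l (∑ i ∈ s, F i) = ∑ i ∈ s, cw l (F i) := by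
  ext m; simp [coeff_cw, coeff_sum]

/-- Base change of an ideal. -/
noncomputable abbrev bc (L : Type*) [Field L] [Algebra K L] (I : Ideal (MvPolynomial (Fin N) K)) :
    Ideal (MvPolynomial (Fin N) L) := I.map (map (algebraMap K L))

theorem mem_bc {I : Ideal (MvPolynomial (Fin N) K)} {F : MvPolynomial (Fin N) L} :
    F ∈ bc L I ↔ ∀ l : L →ₗ[K] K, cw l F ∈ I := by
  classical
  constructor
  · intro h l
    induction h using Submodule.span_induction with
    | mem x h =>
      obtain ⟨p, hp, rfl⟩ := h
      have := cw_mul l p 1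
      rw [mul_one] at this
      rw [this]
      exact Ideal.mul_mem_right _ _ hp
    | zero => rw [cw_zero]; exact zero_mem _
    | add x y _ _ hx hy => rw [cw_add]; exact add_mem hx hy
    | smul a x hx ih =>
      clear ih
      rw [smul_eq_mul]
      induction hx using Submodule.span_induction generalizing a with
      | mem x h =>
        obtain ⟨p, hp, rfl⟩ := h
        rw [mul_comm]
        exact (cw_mul l p a).symm ▸ Ideal.mul_mem_right _ _ hp
      | zero => rw [mul_zero, cw_zero]; exact zero_mem _
      | add x y _ _ hx hy => rw [mul_add, cw_add]; exact add_mem (hx a) (hy a)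
      | smul b x _ hx => rw [smul_eq_mul, ← mul_assoc]; exact hx (a * b)
  · intro h
    let b := Module.Basis.ofVectorSpace K L
    let s := F.support.biUnion fun m => (b.repr (coeff m F)).support
    have e : F = ∑ j ∈ s, C (b j) * map (algebraMap K L) (cw (b.coord j) F) := by
      ext m
      rw [coeff_sum]
      simp only [coeff_C_mul, coeff_map, coeff_cw, Module.Basis.coord_apply]
      by_cases hm : m ∈ F.support
      · conv_lhs => rw [← b.linearCombination_repr (coeff m F)]
        rw [Finsupp.linearCombination_apply, Finsupp.sum_of_support_subset (s := s)]
        · refine Finset.sum_congr rfl fun j _ => ?_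
          rw [Algebra.smul_def, mul_comm]
        · intro j hj
          exact Finset.mem_biUnion.2 ⟨m, hm, hj⟩
        · simp
      · rw [notMem_support_iff] at hm
        rw [hm]
        simp
    rw [e]
    exact sum_mem fun j _ => Ideal.mul_mem_left _ _ (Ideal.mem_map_of_mem _ (h _))

theorem WR_bc (rs : List (MvPolynomial (Fin N) K)) (I : Ideal (MvPolynomial (Fin N) K))
    (h : WR I rs) : WR (bc L I) (rs.map (map (algebraMap K L))) := by
  induction rs generalizing I with
  | nil => simp [WR]
  | cons r rs ih =>
    refine ⟨fun F hF => ?_, ?_⟩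
    · rw [mem_bc] at hF ⊢
      intro l
      have := hF l
      rw [cw_mul] at this
      exact h.1 _ this
    · have := ih _ h.2
      rw [bc, Ideal.map_sup, Ideal.map_span, Set.image_singleton] at this
      exact this

theorem bc_graded {I : Ideal (MvPolynomial (Fin N) K)} (hI : IsGradedIdeal I) :
    IsGradedIdeal (bc L I) := by
  intro F hF d
  rw [mem_bc] at hF ⊢
  intro l
  have : cw l (homogeneousComponent d F) = homogeneousComponent d (cw l F) := by
    ext m
    simp only [coeff_cw, coeff_homogeneousComponent]
    split_ifs <;> simp
  rw [this]
  exact hI _ (hF l) d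

theorem bc_ne_top {I : Ideal (MvPolynomial (Fin N) K)} (hI : I ≠ ⊤) : bc L I ≠ ⊤ := by
  intro h
  rw [Ideal.eq_top_iff_one, mem_bc] at h
  obtain ⟨l, hl⟩ := LinearMap.exists_leftInverse_of_injective (Algebra.linearMap K L)
    (LinearMap.ker_eq_bot.2 (FaithfulSMul.algebraMap_injective K L))
  have h1 := h l
  have h2 := cw_mul (N := N) l 1 1
  have e : cw l (1 : MvPolynomial (Fin N) L) = 1 := by
    ext m
    rw [coeff_cw, coeff_one, coeff_one]
    split_ifs
    · have := LinearMap.congr_fun hl 1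
      simpa using this
    · simp
  rw [e] at h1
  exact hI ((Ideal.eq_top_iff_one _).2 h1)

theorem hilbertFn_bc (I : Ideal (MvPolynomial (Fin N) K)) (d : ℕ) :
    hilbertFn L (bc L I) d = hilbertFn K I d := by
  classical
  let Q := (↥(homogeneousSubmodule (Fin N) K d) ⧸
      (Submodule.comap (homogeneousSubmodule (Fin N) K d).subtype
        (Submodule.restrictScalars K I)))
  let b : Module.Basis (Fin (hilbertFn K I d)) K Q := Module.finBasis K Q
  have hsurj : ∀ i, ∃ e : homogeneousSubmodule (Fin N) K d, Submodule.Quotient.mk e = b i := fun i =>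
    Submodule.Quotient.mk_surjective _ (b i)
  choose e he using hsurj
  let PL := (Submodule.comap (homogeneousSubmodule (Fin N) L d).subtype
        (Submodule.restrictScalars L (bc L I)))
  have hom : ∀ p : homogeneousSubmodule (Fin N) K d,
      map (algebraMap K L) (p : MvPolynomial (Fin N) K) ∈ homogeneousSubmodule (Fin N) L d :=
    fun p => IsHomogeneous.map p.2 _
  let E : Fin (hilbertFn K I d) → homogeneousSubmodule (Fin N) L d := fun i => ⟨_, hom (e i)⟩
  let v : Fin (hilbertFn K I d) → (homogeneousSubmodule (Fin N) L d ⧸ PL) := fun i =>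
    Submodule.Quotient.mk (E i)
  have hli : LinearIndependent L v := by
    rw [Fintype.linearIndependent_iff]
    intro g hg i
    have h1 : ∑ i, g i • E i ∈ PL := by
      rw [← Submodule.Quotient.mk_eq_zero, ← hg]
      show PL.mkQ _ = _
      rw [map_sum]
      rfl
    have h2 : ∑ i, g i • map (algebraMap K L) (e i : MvPolynomial (Fin N) K) ∈ bc L I := by
      have : ((∑ i, g i • E i : homogeneousSubmodule (Fin N) L d) : MvPolynomial (Fin N) L) ∈ bc L I := h1
      rw [Submodule.coe_sum] at this
      exact this
    rw [mem_bc] at h2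
    have h3 : ∀ l : L →ₗ[K] K, l (g i) = 0 := by
      intro l
      have h4 := h2 l
      rw [cw_sum] at h4
      have h5 : ∀ j, cw l (g j • map (algebraMap K L) (e j : MvPolynomial (Fin N) K)) =
          l (g j) • (e j : MvPolynomial (Fin N) K) := by
        intro j
        ext m
        rw [coeff_cw, coeff_smul, coeff_smul, coeff_map, smul_eq_mul, mul_comm, ← Algebra.smul_def,
          map_smul, smul_eq_mul, smul_eq_mul, mul_comm]
      simp only [h5] at h4
      have h6 : ∑ j, l (g j) • b j = 0 := by
        simp only [← he]
        have h7 : (∑ j, l (g j) • e j) ∈ (Submodule.comap (homogeneousSubmodule (Fin N) K d).subtype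
            (Submodule.restrictScalars K I)) := by
          show ((∑ j, l (g j) • e j : homogeneousSubmodule (Fin N) K d) : MvPolynomial (Fin N) K) ∈ I
          rw [Submodule.coe_sum]
          exact h4
        rw [← Submodule.Quotient.mk_eq_zero] at h7
        rw [← h7]
        symm
        exact map_sum (Submodule.mkQ _) _ _
      exact Fintype.linearIndependent_iff.1 b.linearIndependent _ h6 i
    exact (Module.Basis.ofVectorSpace K L).forall_coord_eq_zero_iff.1 fun j => h3 _
  have hsp : ⊤ ≤ Submodule.span L (Set.range v) := by
    have hK : ∀ p : homogeneousSubmodule (Fin N) K d,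
        (Submodule.Quotient.mk ⟨_, hom p⟩ : homogeneousSubmodule (Fin N) L d ⧸ PL) ∈
          Submodule.span L (Set.range v) := by
      intro p
      have h1 := b.sum_repr (Submodule.Quotient.mk p)
      set c := b.repr (Submodule.Quotient.mk p)
      have h2 : (p - ∑ j, c j • e j) ∈ (Submodule.comap (homogeneousSubmodule (Fin N) K d).subtype
            (Submodule.restrictScalars K I)) := by
        rw [← Submodule.Quotient.mk_eq_zero, Submodule.Quotient.mk_sub, sub_eq_zero, ← h1]
        simp only [← he]
        exact (map_sum (Submodule.mkQ _) _ _).symm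
      have h3 : (p : MvPolynomial (Fin N) K) - ∑ j, c j • (e j : MvPolynomial (Fin N) K) ∈ I := by
        have : ((p - ∑ j, c j • e j : homogeneousSubmodule (Fin N) K d) : MvPolynomial (Fin N) K) ∈ I := h2
        rw [Submodule.coe_sub, Submodule.coe_sum] at this
        exact this
      have h4 := Ideal.mem_map_of_mem (map (algebraMap K L)) h3
      rw [map_sub, map_sum] at h4
      have h5 : (Submodule.Quotient.mk ⟨_, hom p⟩ : homogeneousSubmodule (Fin N) L d ⧸ PL) =
          ∑ j, (algebraMap K L (c j)) • v j := by
        have h6 : (⟨_, hom p⟩ : homogeneousSubmodule (Fin N) L d) - ∑ j, (algebraMap K L (c j)) • E j ∈ PL := by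
          show (((⟨_, hom p⟩ : homogeneousSubmodule (Fin N) L d) - ∑ j, (algebraMap K L (c j)) • E j :
            homogeneousSubmodule (Fin N) L d) : MvPolynomial (Fin N) L) ∈ bc L I
          rw [Submodule.coe_sub, Submodule.coe_sum]
          convert h4 using 3 with j
          show algebraMap K L (c j) • map (algebraMap K L) (e j : MvPolynomial (Fin N) K) = _
          rw [smul_eq_C_mul, smul_eq_C_mul, map_mul, map_C]
        rw [← Submodule.Quotient.mk_eq_zero, Submodule.Quotient.mk_sub, sub_eq_zero] at h6
        rw [h6]
        exact map_sum (Submodule.mkQ _) _ _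
      rw [h5]
      exact sum_mem fun j _ => Submodule.smul_mem _ _ (Submodule.subset_span ⟨j, rfl⟩)
    rintro x -
    obtain ⟨F, rfl⟩ := Submodule.Quotient.mk_surjective _ x
    have hmon : ∀ m ∈ (F : MvPolynomial (Fin N) L).support,
        (monomial m (1 : K)) ∈ homogeneousSubmodule (Fin N) K d := by
      intro m hm
      apply isHomogeneous_monomial
      rw [Finsupp.degree_eq_weight_one]
      exact F.2 (mem_support_iff.1 hm)
    have e : F = ∑ m ∈ (F : MvPolynomial (Fin N) L).support.attach,
        coeff m.1 (F : MvPolynomial (Fin N) L) • (⟨_, hom ⟨_, hmon m.1 m.2⟩⟩ : homogeneousSubmodule (Fin N) L d) := by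
      apply Subtype.ext
      rw [Submodule.coe_sum]
      conv_lhs => rw [(F : MvPolynomial (Fin N) L).as_sum, ← Finset.sum_attach]
      refine Finset.sum_congr rfl fun m _ => ?_
      simp [smul_monomial]
    rw [e]
    have : (Submodule.Quotient.mk (∑ m ∈ (F : MvPolynomial (Fin N) L).support.attach,
        coeff m.1 (F : MvPolynomial (Fin N) L) • (⟨_, hom ⟨_, hmon m.1 m.2⟩⟩ : homogeneousSubmodule (Fin N) L d)) :
        homogeneousSubmodule (Fin N) L d ⧸ PL) = ∑ m ∈ (F : MvPolynomial (Fin N) L).support.attach,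
        coeff m.1 (F : MvPolynomial (Fin N) L) • Submodule.Quotient.mk (⟨_, hom ⟨_, hmon m.1 m.2⟩⟩ : homogeneousSubmodule (Fin N) L d) :=
      map_sum PL.mkQ _ _
    rw [this]
    exact sum_mem fun m _ => Submodule.smul_mem _ _ (hK _)
  show Module.finrank L (homogeneousSubmodule (Fin N) L d ⧸ PL) = _
  rw [Module.finrank_eq_card_basis (Module.Basis.mk hli hsp), Fintype.card_fin]

end BC
end EGH

namespace EGH
open Finset

/-- partial sums -/
def ps (h : ℕ → ℕ) (d : ℕ) : ℕ := ∑ i ∈ Finset.range (d + 1), h i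

section Gen
variable {N : ℕ} {L : Type*} [Field L]

theorem hilbertFn_ps {I : Ideal (MvPolynomial (Fin N) L)} (hI : IsGradedIdeal I)
    {l : MvPolynomial (Fin N) L} (hl : l.IsHomogeneous 1) (hr : ∀ x, l * x ∈ I → x ∈ I) :
    hilbertFn L I = ps (hilbertFn L (I ⊔ Ideal.span {l})) := by
  have hc : col I l = I := by
    ext x
    rw [mem_col]
    exact ⟨hr x, fun h => Ideal.mul_mem_left _ _ h⟩
  funext d
  induction d with
  | zero => rw [hilbertFn_zero_step hI hl]; simp [ps]
  | succ d ih =>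
    rw [hilbertFn_step hI hl, hc, ih, ps, ps, Finset.sum_range_succ _ (d+1)]

theorem avoid [Infinite L] (Q : Set (Submodule L (MvPolynomial (Fin N) L))) (hfin : Q.Finite)
    (h : ∀ q ∈ Q, ¬ homogeneousSubmodule (Fin N) L 1 ≤ q) :
    ∃ l : MvPolynomial (Fin N) L, l.IsHomogeneous 1 ∧ ∀ q ∈ Q, l ∉ q := by
  have : Finite Q := hfin
  obtain ⟨x, hx⟩ := Submodule.exists_forall_notMem_of_forall_ne_top
    (fun q : Q => q.1.comap (homogeneousSubmodule (Fin N) L 1).subtype) (by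
      intro q e
      apply h q.1 q.2
      intro y hy
      have : (⟨y, hy⟩ : homogeneousSubmodule (Fin N) L 1) ∈
        q.1.comap (homogeneousSubmodule (Fin N) L 1).subtype := by rw [e]; trivial
      exact this)
  exact ⟨x, x.2, fun q hq hm => hx ⟨q, hq⟩ hm⟩

theorem zd_finite (I : Ideal (MvPolynomial (Fin N) L)) (r : MvPolynomial (Fin N) L)
    (hr : ∀ x, r * x ∈ I → x ∈ I)
    (hrm : r ∈ Ideal.span (Set.range (X : Fin N → MvPolynomial (Fin N) L))) :
    ∃ Q : Set (Submodule L (MvPolynomial (Fin N) L)), Q.Finite ∧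
      (∀ q ∈ Q, ¬ homogeneousSubmodule (Fin N) L 1 ≤ q) ∧
      ∀ l, (∀ q ∈ Q, l ∉ q) → ∀ x, l * x ∈ I → x ∈ I := by
  have key := biUnion_associatedPrimes_eq_zero_divisors (MvPolynomial (Fin N) L)
    (MvPolynomial (Fin N) L ⧸ I)
  refine ⟨(fun P : Ideal (MvPolynomial (Fin N) L) => P.restrictScalars L) ''
    (associatedPrimes (MvPolynomial (Fin N) L) (MvPolynomial (Fin N) L ⧸ I)),
    (associatedPrimes.finite _ _).image _, ?_, ?_⟩
  · rintro _ ⟨P, hP, rfl⟩ hV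
    have hrP : r ∈ P := by
      have : Ideal.span (Set.range (X : Fin N → MvPolynomial (Fin N) L)) ≤ P := by
        rw [Ideal.span_le]
        rintro _ ⟨i, rfl⟩
        exact hV (isHomogeneous_X _ _)
      exact this hrm
    have : r ∈ ⋃ p ∈ associatedPrimes (MvPolynomial (Fin N) L) (MvPolynomial (Fin N) L ⧸ I),
        (p : Set (MvPolynomial (Fin N) L)) := Set.mem_biUnion hP hrP
    rw [key] at this
    obtain ⟨x, hx, hx0⟩ := this
    obtain ⟨y, rfl⟩ := Ideal.Quotient.mk_surjective x
    apply hx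
    rw [Ideal.Quotient.eq_zero_iff_mem]
    apply hr
    rw [← Ideal.Quotient.eq_zero_iff_mem, ← hx0]
    rfl
  · intro l hl x hx
    by_contra hxI
    have : l ∈ ⋃ p ∈ associatedPrimes (MvPolynomial (Fin N) L) (MvPolynomial (Fin N) L ⧸ I),
        (p : Set (MvPolynomial (Fin N) L)) := by
      rw [key]
      refine ⟨Ideal.Quotient.mk I x, ?_, ?_⟩
      · rwa [Ne, Ideal.Quotient.eq_zero_iff_mem]
      · show Ideal.Quotient.mk I (l * x) = 0
        rwa [Ideal.Quotient.eq_zero_iff_mem]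
    simp only [Set.mem_iUnion] at this
    obtain ⟨P, hP, hlP⟩ := this
    exact hl _ ⟨P, hP, rfl⟩ hlP

theorem generic_step [Infinite L] (G : Set (List (MvPolynomial (Fin N) L))) (hGf : G.Finite)
    (hG : ∀ g ∈ G, ∀ p ∈ g, p.IsHomogeneous 1) {t : ℕ} (a : Fin t → ℕ)
    (U : Submodule L (MvPolynomial (Fin N) L)) (hU : U ≤ homogeneousSubmodule (Fin N) L 1)
    (hC : Cond G a U) (hdim : t + 1 + Module.finrank L U ≤ N)
    (I : Ideal (MvPolynomial (Fin N) L)) (rs : List (MvPolynomial (Fin N) L)) (hrs : WR I rs)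
    (hne : rs ≠ [])
    (hm : ∀ y ∈ rs, y ∈ Ideal.span (Set.range (X : Fin N → MvPolynomial (Fin N) L))) :
    ∃ l : MvPolynomial (Fin N) L, l.IsHomogeneous 1 ∧ l ∉ U ∧ (∀ x, l * x ∈ I → x ∈ I) ∧
      WR (I ⊔ Ideal.span {l}) (rs.take (rs.length - 1)) ∧ Cond G a (U ⊔ Submodule.span L {l}) := by
  classical
  let Φ : Set (MvPolynomial (Fin N) L) := ⋃ g ∈ G, {p | p ∈ g}
  have hΦ : Φ.Finite := hGf.biUnion fun g _ => List.finite_toSet g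
  have hΦ1 : Φ ⊆ (homogeneousSubmodule (Fin N) L 1 : Submodule L _) := by
    intro p hp
    simp only [Φ, Set.mem_iUnion] at hp
    obtain ⟨g, hg, hp⟩ := hp
    exact hG g hg p hp
  let Q1 : Set (Submodule L (MvPolynomial (Fin N) L)) :=
    ((fun T : Set (MvPolynomial (Fin N) L) => U ⊔ Submodule.span L T) '' (𝒫 Φ)) ∩
      {q | ¬ homogeneousSubmodule (Fin N) L 1 ≤ q}
  have hQ1 : Q1.Finite := (hΦ.powerset.image _).inter_of_left _
  have hrs' := (WR_iff I rs).1 hrs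
  choose Q hQf hQp hQ using fun j : Fin rs.length =>
    zd_finite (I ⊔ Ideal.ofList (rs.take j)) rs[j] (hrs' j j.2) (hm _ (by simp))
  obtain ⟨l, hl1, hl⟩ := avoid (Q1 ∪ ⋃ j, Q j) (hQ1.union (Set.finite_iUnion hQf)) (by
    rintro q (hq | hq)
    · exact hq.2
    · obtain ⟨j, hj⟩ := Set.mem_iUnion.1 hq
      exact hQp j q hj)
  have hlr : ∀ j < rs.length, ∀ x, l * x ∈ I ⊔ Ideal.ofList (rs.take j) →
      x ∈ I ⊔ Ideal.ofList (rs.take j) := by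
    intro j hj x
    exact hQ ⟨j, hj⟩ l (fun q hq => hl q (Or.inr (Set.mem_iUnion.2 ⟨_, hq⟩))) x
  have hVU : ¬ homogeneousSubmodule (Fin N) L 1 ≤ U := by
    intro h
    have := fd_of_le hU
    have := Submodule.finrank_mono h
    rw [finrank_hom_one] at this
    omega
  have hlU : l ∉ U := by
    apply hl
    left
    refine ⟨⟨∅, by simp, by simp⟩, hVU⟩
  refine ⟨l, hl1, hlU, ?_, WR_swap rs I l hrs hlr, ?_⟩
  · intro x hx
    have := hlr 0 (List.length_pos_of_ne_nil hne) x
    simpa using this (by simpa using hx)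
  · intro i W hW hUW hgW
    rw [finrank_sup_span hU hl1 hlU]
    have hlW : l ∈ W := hUW (Submodule.mem_sup_right (Submodule.mem_span_singleton_self l))
    have hUW' : U ≤ W := le_sup_left.trans hUW
    have hfd := fd_of_le hW
    set WT := U ⊔ Submodule.span L (Φ ∩ W) with hWT
    have hle : WT ≤ W := sup_le hUW' (Submodule.span_le.2 Set.inter_subset_right)
    have h1 := hC i WT (hle.trans hW) le_sup_left (by
      intro g hg hgl
      obtain ⟨p, hp, hpW⟩ := hgW g hg hgl
      refine ⟨p, hp, Submodule.mem_sup_right (Submodule.subset_span ⟨?_, hpW⟩)⟩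
      exact Set.mem_biUnion hg hp)
    by_cases hV : homogeneousSubmodule (Fin N) L 1 ≤ WT
    · have := Submodule.finrank_mono (hV.trans hle)
      rw [finrank_hom_one] at this
      have := i.2
      omega
    · have hlT : l ∉ WT := hl _ (Or.inl ⟨⟨_, Set.inter_subset_left, rfl⟩, hV⟩)
      have hlt : WT < W := lt_of_le_of_ne hle fun e => hlT (e ▸ hlW)
      have := Submodule.finrank_lt_finrank_of_lt hlt
      omega

theorem generic [Infinite L] (G : Set (List (MvPolynomial (Fin N) L))) (hGf : G.Finite)
    (hG : ∀ g ∈ G, ∀ p ∈ g, p.IsHomogeneous 1) {t : ℕ} (a : Fin t → ℕ) (k : ℕ)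
    (U : Submodule L (MvPolynomial (Fin N) L)) (hU : U ≤ homogeneousSubmodule (Fin N) L 1)
    (hC : Cond G a U) (hdim : t + k + Module.finrank L U ≤ N)
    (I : Ideal (MvPolynomial (Fin N) L)) (hI : IsGradedIdeal I) (hUI : ∀ u ∈ U, u ∈ I)
    (rs : List (MvPolynomial (Fin N) L)) (hrs : WR I rs) (hk : rs.length = k)
    (hm : ∀ y ∈ rs, y ∈ Ideal.span (Set.range (X : Fin N → MvPolynomial (Fin N) L))) :
    ∃ (U' : Submodule L (MvPolynomial (Fin N) L)) (I' : Ideal (MvPolynomial (Fin N) L)),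
      IsGradedIdeal I' ∧ U' ≤ homogeneousSubmodule (Fin N) L 1 ∧
      Module.finrank L U' = Module.finrank L U + k ∧ (∀ u ∈ U', u ∈ I') ∧ I ≤ I' ∧
      Cond G a U' ∧ hilbertFn L I = ps^[k] (hilbertFn L I') := by
  induction k generalizing U I rs with
  | zero => exact ⟨U, I, hI, hU, by simp, hUI, le_rfl, hC, rfl⟩
  | succ k ih =>
    obtain ⟨l, hl1, hlU, hlI, hWR, hC'⟩ := generic_step G hGf hG a U hU hC (by omega) I rs hrs
      (by rintro rfl; simp at hk) hm
    have hfr := finrank_sup_span hU hl1 hlU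
    obtain ⟨U', I', h1, h2, h3, h4, h5, h6, h7⟩ := ih (U ⊔ Submodule.span L {l})
      (sup_le hU (by rw [Submodule.span_singleton_le_iff_mem]; exact hl1)) hC' (by omega)
      (I ⊔ Ideal.span {l}) (sup_graded hI hl1) (by
        intro u hu
        obtain ⟨y, hy, z, hz, rfl⟩ := Submodule.mem_sup.1 hu
        obtain ⟨c, rfl⟩ := Submodule.mem_span_singleton.1 hz
        refine add_mem (Ideal.mem_sup_left (hUI y hy)) (Ideal.mem_sup_right ?_)
        rw [smul_eq_C_mul]
        exact Ideal.mul_mem_left _ _ (Ideal.mem_span_singleton_self l)) _ hWR (by simp [hk])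
        (fun y hy => hm y (List.mem_of_mem_take hy))
    refine ⟨U', I', h1, h2, by omega, h4, le_sup_left.trans h5, h6, ?_⟩
    rw [hilbertFn_ps hI hl1 hlI, h7, Function.iterate_succ_apply']

end Gen
end EGH

namespace EGH
open Finset

section Main
variable {N : ℕ} {K : Type*} [Field K]

theorem prod_hom (g : List (MvPolynomial (Fin N) K)) (h : ∀ p ∈ g, p.IsHomogeneous 1) :
    g.prod.IsHomogeneous g.length := by
  induction g with
  | nil => simpa using isHomogeneous_one (Fin N) K
  | cons p g ih =>
    rw [List.prod_cons, List.length_cons, add_comm]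
    exact (h p (by simp)).mul (ih fun q hq => h q (by simp [hq]))

theorem span_low (G : Set (List (MvPolynomial (Fin N) K)))
    (hG : ∀ g ∈ G, ∀ p ∈ g, p.IsHomogeneous 1) (f : MvPolynomial (Fin N) K) (e : ℕ)
    (hf : f.IsHomogeneous e) (hfG : f ∈ Ideal.span (List.prod '' G)) :
    f ∈ Ideal.span (List.prod '' {g ∈ G | g.length ≤ e}) := by
  have key : ∀ x ∈ Ideal.span (List.prod '' G), ∀ c, homogeneousComponent e (c * x) ∈
      Ideal.span (List.prod '' {g ∈ G | g.length ≤ e}) := by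
    intro x hx
    induction hx using Submodule.span_induction with
    | mem x h =>
      obtain ⟨g, hg, rfl⟩ := h
      intro c
      have hh := prod_hom g (hG g hg)
      rw [mul_comm]
      by_cases hle : g.length ≤ e
      · obtain ⟨d, rfl⟩ := Nat.exists_eq_add_of_le' hle
        rw [hc_mul hh]
        exact Ideal.mul_mem_right _ _ (Ideal.subset_span ⟨g, ⟨hg, hle⟩, rfl⟩)
      · rw [hc_mul_lt hh (by omega)]
        exact zero_mem _
    | zero => intro c; simp
    | add x y _ _ hx hy => intro c; rw [mul_add, map_add]; exact add_mem (hx c) (hy c)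
    | smul b x _ hx => intro c; rw [smul_eq_mul, ← mul_assoc]; exact hx _
  have := key f hfG 1
  rwa [one_mul, homogeneousComponent_of_mem hf, if_pos rfl] at this

theorem gens_exist {n t : ℕ} {K : Type*} [Field K]
    (M : Ideal (MvPolynomial (Fin n) K)) (hred : TotallyReducible M)
    (a : Fin t → ℕ)
    (f : Fin t → MvPolynomial (Fin n) K)
    (hfM : ∀ i, f i ∈ M)
    (hfhom : ∀ i, (f i).IsHomogeneous (a i)) :
    ∃ G1 : Set (List (MvPolynomial (Fin n) K)), G1.Finite ∧
      (∀ g ∈ G1, ∀ p ∈ g, p.IsHomogeneous 1) ∧ (∀ g ∈ G1, g.prod ∈ M) ∧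
      ∀ i, f i ∈ Ideal.span (List.prod '' {g ∈ G1 | g.length ≤ a i}) := by
  classical
  obtain ⟨Gall, hGall⟩ : ∃ Gall : Set (List (MvPolynomial (Fin n) K)),
    ∀ g, g ∈ Gall ↔ (∀ p ∈ g, p.IsHomogeneous 1) ∧ g.prod ∈ M := ⟨{g | _}, fun g => Iff.rfl⟩
  have hMG : M ≤ Ideal.span (List.prod '' Gall) := by
    obtain ⟨G0, hG0, hG1⟩ := hred
    conv_lhs => rw [hG0]
    apply Ideal.span_mono
    intro g hg
    obtain ⟨k, l, hl, rfl⟩ := hG1 g hg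
    refine ⟨List.ofFn l, (hGall _).2 ⟨?_, ?_⟩, List.prod_ofFn⟩
    · intro p hp
      rw [List.mem_ofFn] at hp
      obtain ⟨i, rfl⟩ := hp
      exact hl i
    · rw [List.prod_ofFn, hG0]
      exact Ideal.subset_span hg
  have hfin : ∀ i, ∃ s : Finset (List (MvPolynomial (Fin n) K)), (s : Set _) ⊆ Gall ∧
      f i ∈ Ideal.span (List.prod '' (s : Set (List (MvPolynomial (Fin n) K)))) := by
    intro i
    obtain ⟨T, hT, hfT⟩ := Submodule.mem_span_finite_of_mem_span (hMG (hfM i))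
    obtain ⟨s, hs, rfl⟩ := Finset.subset_set_image_iff.1 hT
    refine ⟨s, hs, ?_⟩
    rw [Finset.coe_image] at hfT
    exact hfT
  choose s hs hfs using hfin
  refine ⟨⋃ i, (s i : Set (List (MvPolynomial (Fin n) K))),
    Set.finite_iUnion fun i => (s i).finite_toSet, ?_, ?_, ?_⟩
  · intro g hg
    obtain ⟨i, hi⟩ := Set.mem_iUnion.1 hg
    exact ((hGall g).1 (hs i hi)).1
  · intro g hg
    obtain ⟨i, hi⟩ := Set.mem_iUnion.1 hg
    exact ((hGall g).1 (hs i hi)).2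
  · intro i
    have h1 := span_low (s i : Set (List (MvPolynomial (Fin n) K)))
      (fun g hg => ((hGall g).1 (hs i hg)).1) (f i) (a i) (hfhom i) (hfs i)
    refine Ideal.span_mono (Set.image_mono ?_) h1
    intro g hg
    exact ⟨Set.mem_iUnion.2 ⟨i, hg.1⟩, hg.2⟩

theorem cond_init {n t : ℕ} {K L : Type*} [Field K] [Field L] [Algebra K L]
    (a : Fin t → ℕ) (ha : Monotone a)
    (f : Fin t → MvPolynomial (Fin n) K) (G1 : Set (List (MvPolynomial (Fin n) K)))
    (hflow : ∀ i, f i ∈ Ideal.span (List.prod '' {g ∈ G1 | g.length ≤ a i}))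
    (hfL : WR (⊥ : Ideal (MvPolynomial (Fin n) L)) ((List.ofFn f).map (map (algebraMap K L)))) :
    Cond ((List.map (map (algebraMap K L))) '' G1) a (⊥ : Submodule L (MvPolynomial (Fin n) L)) := by
  intro i W hW _ hgW
  have hpr := lin_prime hW
  obtain ⟨P0, -, -, -, hh⟩ := WR_height _ ⊥ (WR_take hfL (i+1))
    (Ideal.span (W : Set (MvPolynomial (Fin n) L))) (by
      rw [bot_sup_eq, Ideal.span_le]
      intro x (hx : x ∈ ((List.ofFn f).map (map (algebraMap K L))).take (i+1))
      obtain ⟨j, hj, rfl⟩ := List.mem_take_iff_getElem.1 hx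
      have hj' : j < i.1 + 1 ∧ j < t := by
        have hj2 := hj
        simp at hj2
        have := i.2
        omega
      rw [List.getElem_map, List.getElem_ofFn]
      have hle : Ideal.span (List.prod '' {g ∈ G1 | g.length ≤ a ⟨j, hj'.2⟩}) ≤
          (Ideal.span (W : Set (MvPolynomial (Fin n) L))).comap (map (algebraMap K L)) := by
        rw [Ideal.span_le]
        rintro _ ⟨g, ⟨hg, hgl⟩, rfl⟩
        show (map (algebraMap K L)) g.prod ∈ Ideal.span (W : Set (MvPolynomial (Fin n) L))
        have haj : a ⟨j, hj'.2⟩ ≤ a i := ha (by show j ≤ i.1; omega)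
        obtain ⟨p, hp, hpW⟩ := hgW (g.map (map (algebraMap K L))) ⟨g, hg, rfl⟩ (by rw [List.length_map]; omega)
        rw [← List.prod_hom]
        exact Ideal.mem_of_dvd _ (List.dvd_prod hp) (Ideal.subset_span hpW)
      exact hle (hflow ⟨j, hj'.2⟩))
  have h1 := (le_trans (le_add_self) hh).trans (lin_height_le hW)
  have h2 : ((i : ℕ) + 1 : ℕ) ≤ Module.finrank L W := by
    have h3 : (((List.ofFn f).map (map (algebraMap K L))).take (i+1)).length = i + 1 := by
      simp
    rw [h3] at h1
    exact_mod_cast h1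
  rw [finrank_bot]
  omega

theorem main_mac_aux {n t : ℕ} (htn : t ≤ n) (K L : Type*) [Field K] [Field L] [Algebra K L] [Infinite L]
    (M : Ideal (MvPolynomial (Fin n) K)) (hred : TotallyReducible M)
    (a : Fin t → ℕ) (ha : Monotone a)
    (f : Fin t → MvPolynomial (Fin n) K)
    (hfM : ∀ i, f i ∈ M)
    (hfhom : ∀ i, (f i).IsHomogeneous (a i))
    (hfreg : RingTheory.Sequence.IsRegular (MvPolynomial (Fin n) K) (List.ofFn f))
    (I : Ideal (MvPolynomial (Fin n) K)) (hIgr : IsGradedIdeal I) (hMI : M ≤ I)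
    (hht : idealHeight I = t) (hCM : QuotientIsCM I) :
    I ≠ ⊤ ∧ ∃ h : ℕ → ℕ, Mac a h ∧ hilbertFn K I = ps^[n - t] h := by
  classical
  obtain ⟨rs, hlen, hm, hWR, hIne⟩ := cm_seq K M hred f hfM hfreg I hMI hht hCM
  refine ⟨hIne, ?_⟩
  obtain ⟨G1, hG1f, hG1l, hG1M, hflow⟩ := gens_exist M hred a f hfM hfhom
  let μ : MvPolynomial (Fin n) K →+* MvPolynomial (Fin n) L := map (algebraMap K L)
  let G : Set (List (MvPolynomial (Fin n) L)) := (List.map μ) '' G1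
  have hGf : G.Finite := hG1f.image _
  have hGl : ∀ g ∈ G, ∀ p ∈ g, p.IsHomogeneous 1 := by
    rintro _ ⟨g, hg, rfl⟩ p hp
    obtain ⟨q, hq, rfl⟩ := List.mem_map.1 hp
    exact IsHomogeneous.map (hG1l g hg q hq) _
  have hGI : ∀ g ∈ G, g.prod ∈ bc L I := by
    rintro _ ⟨g, hg, rfl⟩
    rw [List.prod_hom]
    exact Ideal.mem_map_of_mem _ (hMI (hG1M g hg))
  have hfL : WR (⊥ : Ideal (MvPolynomial (Fin n) L)) ((List.ofFn f).map μ) := by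
    have := WR_bc (L := L) _ _ ((isWeaklyRegular_iff_WR _).1 hfreg.toIsWeaklyRegular)
    rwa [bc, Ideal.map_bot] at this
  have hC : Cond G a (⊥ : Submodule L (MvPolynomial (Fin n) L)) := cond_init a ha f G1 hflow hfL
  obtain ⟨U', I', h1, h2, h3, h4, h5, h6, h7⟩ := generic G hGf hGl a (n - t) ⊥ bot_le hC
    (by rw [finrank_bot]; omega) (bc L I) (bc_graded hIgr) (by
      intro u hu
      rw [Submodule.mem_bot] at hu
      rw [hu]; exact zero_mem _)
    (rs.map μ) (WR_bc _ _ hWR) (by simpa using hlen) (by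
      intro y hy
      obtain ⟨q, hq, rfl⟩ := List.mem_map.1 hy
      have h := Ideal.mem_map_of_mem μ (hm q hq)
      rw [Ideal.map_span, ← Set.range_comp] at h
      convert h using 3
      funext i
      simp [μ])
  refine ⟨hilbertFn L I', ?_, ?_⟩
  · exact egh_step G hGl t a ha U' h2 (by rw [h3, finrank_bot]; omega) h6 I' h1 h4
      fun g hg => h5 (hGI g hg)
  · rw [← h7]
    funext d
    rw [hilbertFn_bc]

theorem main_mac {n t : ℕ} (htn : t ≤ n) (K : Type*) [Field K]
    (M : Ideal (MvPolynomial (Fin n) K)) (hred : TotallyReducible M)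
    (a : Fin t → ℕ) (ha : Monotone a)
    (f : Fin t → MvPolynomial (Fin n) K)
    (hfM : ∀ i, f i ∈ M)
    (hfhom : ∀ i, (f i).IsHomogeneous (a i))
    (hfreg : RingTheory.Sequence.IsRegular (MvPolynomial (Fin n) K) (List.ofFn f))
    (I : Ideal (MvPolynomial (Fin n) K)) (hIgr : IsGradedIdeal I) (hMI : M ≤ I)
    (hht : idealHeight I = t) (hCM : QuotientIsCM I) :
    I ≠ ⊤ ∧ ∃ h : ℕ → ℕ, Mac a h ∧ hilbertFn K I = ps^[n - t] h := by
  have : Infinite (AlgebraicClosure K) := IsAlgClosed.instInfinite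
  exact main_mac_aux htn K (AlgebraicClosure K) M hred a ha f hfM hfhom hfreg I hIgr hMI hht hCM

end Main
end EGH

namespace EGH
open Finset

section Mon
variable {n : ℕ} {K : Type*} [Field K]

/-- monomial ideal attached to an upper set -/
def MI (K : Type*) [Field K] (T : Set (Fin n →₀ ℕ)) (hT : IsUpperSet T) :
    Ideal (MvPolynomial (Fin n) K) where
  carrier := {F | ∀ m, coeff m F ≠ 0 → m ∈ T}
  zero_mem' := by intro m hm; simp at hm
  add_mem' := by
    intro F G hF hG m hm
    by_cases h : coeff m F = 0
    · apply hG
      intro h'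
      apply hm
      rw [coeff_add, h, h', add_zero]
    · exact hF m h
  smul_mem' := by
    classical
    intro c F hF m hm
    rw [smul_eq_mul, coeff_mul] at hm
    obtain ⟨x, hx, hne⟩ := Finset.exists_ne_zero_of_sum_ne_zero hm
    have h1 := hF x.2 (right_ne_zero_of_mul hne)
    rw [Finset.HasAntidiagonal.mem_antidiagonal] at hx
    exact hT (by rw [← hx]; exact le_add_self) h1

theorem mem_MI {T : Set (Fin n →₀ ℕ)} {hT : IsUpperSet T} {F : MvPolynomial (Fin n) K} :
    F ∈ MI K T hT ↔ ∀ m, coeff m F ≠ 0 → m ∈ T := Iff.rfl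

theorem monomial_mem_MI {T : Set (Fin n →₀ ℕ)} {hT : IsUpperSet T} {m : Fin n →₀ ℕ} (hm : m ∈ T)
    (c : K) : monomial m c ∈ MI K T hT := by
  classical
  rw [mem_MI]
  intro m' h
  rw [coeff_monomial] at h
  split_ifs at h with h1
  · exact h1 ▸ hm
  · exact absurd rfl h

theorem MI_graded {T : Set (Fin n →₀ ℕ)} {hT : IsUpperSet T} : IsGradedIdeal (MI K T hT) := by
  intro F hF d m hm
  rw [coeff_homogeneousComponent] at hm
  split_ifs at hm with h
  · exact hF m hm
  · exact absurd rfl hm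

theorem MI_reg {T : Set (Fin n →₀ ℕ)} {hT : IsUpperSet T} (j : Fin n)
    (h : ∀ m, Finsupp.single j 1 + m ∈ T → m ∈ T) (x : MvPolynomial (Fin n) K)
    (hx : X j * x ∈ MI K T hT) : x ∈ MI K T hT := by
  intro m hm
  apply h
  apply hx
  rwa [coeff_X_mul]

theorem MI_sup {T T' : Set (Fin n →₀ ℕ)} {hT : IsUpperSet T} {hT' : IsUpperSet T'} (j : Fin n)
    (h : ∀ m, m ∈ T' ↔ m ∈ T ∨ m j ≠ 0) :
    MI K T hT ⊔ Ideal.span {X j} = MI K T' hT' := by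
  apply le_antisymm
  · refine sup_le ?_ ?_
    · intro F hF m hm
      exact (h m).2 (Or.inl (hF m hm))
    · rw [Ideal.span_singleton_le_iff_mem]
      exact monomial_mem_MI ((h _).2 (Or.inr (by simp))) _
  · intro F hF
    rw [F.as_sum]
    refine sum_mem fun m hm => ?_
    rcases (h m).1 (hF m (mem_support_iff.1 hm)) with h1 | h1
    · exact Ideal.mem_sup_left (monomial_mem_MI h1 _)
    · refine Ideal.mem_sup_right (Ideal.mem_span_singleton.2 ?_)
      rw [X_dvd_monomial]
      exact Or.inr h1

end Mon

section Con
variable {n t : ℕ} {a : Fin t → ℕ}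

theorem up_aux {A : ℕ → Finset (Fin t → ℕ)} (hSh : ∀ e, Sh a e (A e) ⊆ A (e + 1)) (k : ℕ) :
    ∀ e (w w' : Fin t → ℕ), w ∈ A e → w ∈ Bx a e → w' ∈ Bx a (e + k) → w ≤ w' → w' ∈ A (e + k) := by
  induction k with
  | zero =>
    intro e w w' hw hwB hwB' hle
    have hle' : ∀ i, w i ≤ w' i := hle
    have : w = w' := by
      rw [mem_Bx] at hwB hwB'
      have := (Finset.sum_eq_sum_iff_of_le (fun i _ => hle' i)).1 (hwB.2.trans hwB'.2.symm)
      funext i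
      exact this i (Finset.mem_univ i)
    rw [← this]; exact hw
  | succ k ih =>
    intro e w w' hw hwB hwB' hle
    have hle' : ∀ i, w i ≤ w' i := hle
    have hB := mem_Bx.1 hwB
    have hB' := mem_Bx.1 hwB'
    obtain ⟨i, hi⟩ : ∃ i, w i < w' i := by
      by_contra! hcon
      have := Finset.sum_le_sum fun i (_ : i ∈ Finset.univ) => hcon i
      omega
    have hu : Function.update w i (w i + 1) ∈ Bx a (e+1) := inc_mem hwB i (by have := hB'.1 i; omega)
    have hwu : w ≤ Function.update w i (w i + 1) := by
      intro j
      by_cases hj : j = i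
      · subst hj; simp
      · simp [hj]
    have hA : Function.update w i (w i + 1) ∈ A (e+1) := hSh e (mem_Sh.2 ⟨hu, w, hw, hwu⟩)
    have e1 : e + (k + 1) = e + 1 + k := by omega
    rw [e1] at hwB' ⊢
    refine ih (e+1) _ w' hA hu hwB' ?_
    intro j
    by_cases hj : j = i
    · subst hj; simp; omega
    · simp [hj, hle' j]

/-- exponents excluded -/
def Ex (a : Fin t → ℕ) (A : ℕ → Finset (Fin t → ℕ)) (w : Fin t → ℕ) : Prop :=
  w ∈ Bx a (∑ i, w i) → w ∈ A (∑ i, w i)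

theorem Ex_up {A : ℕ → Finset (Fin t → ℕ)} (hSh : ∀ e, Sh a e (A e) ⊆ A (e + 1))
    {w w' : Fin t → ℕ} (hle : w ≤ w') (h : Ex a A w) : Ex a A w' := by
  intro hB'
  have hle' : ∀ i, w i ≤ w' i := hle
  have hB : w ∈ Bx a (∑ i, w i) := mem_Bx.2 ⟨fun i => (hle' i).trans_lt ((mem_Bx.1 hB').1 i), rfl⟩
  have hs := Finset.sum_le_sum fun i (_ : i ∈ Finset.univ) => hle' i
  obtain ⟨k, hk⟩ := Nat.exists_eq_add_of_le hs
  rw [hk] at hB' ⊢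
  exact up_aux hSh k _ w w' (h hB) hB hB' hle

/-- restriction of exponents to first `t` variables -/
def rst (htn : t ≤ n) (m : Fin n →₀ ℕ) : Fin t → ℕ := fun i => m (Fin.castLE htn i)

/-- the upper sets -/
def UTT (htn : t ≤ n) (a : Fin t → ℕ) (A : ℕ → Finset (Fin t → ℕ)) (k : ℕ) : Set (Fin n →₀ ℕ) :=
  {m | Ex a A (rst htn m) ∨ ∃ j : Fin n, t ≤ j.val ∧ j.val < t + k ∧ m j ≠ 0}

theorem UTT_up (htn : t ≤ n) {A : ℕ → Finset (Fin t → ℕ)} (hSh : ∀ e, Sh a e (A e) ⊆ A (e + 1)) (k : ℕ) :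
    IsUpperSet (UTT htn a A k) := by
  intro m m' hle hm
  have hle' : ∀ i, m i ≤ m' i := hle
  rcases hm with h | ⟨j, h1, h2, h3⟩
  · exact Or.inl (Ex_up hSh (fun i => hle' _) h)
  · refine Or.inr ⟨j, h1, h2, ?_⟩
    have := hle' j
    omega

variable (K : Type*) [Field K]

/-- regular variables -/
noncomputable def vv (n t : ℕ) : Fin (n - t) → MvPolynomial (Fin n) K :=
  fun i => X ⟨t + i, by omega⟩

theorem UTT_step (htn : t ≤ n) {A : ℕ → Finset (Fin t → ℕ)} (k : ℕ) (hk : t + k < n) (m : Fin n →₀ ℕ) :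
    m ∈ UTT htn a A (k+1) ↔ m ∈ UTT htn a A k ∨ m ⟨t + k, hk⟩ ≠ 0 := by
  constructor
  · rintro (h | ⟨j, h1, h2, h3⟩)
    · exact Or.inl (Or.inl h)
    · by_cases hj : j.val < t + k
      · exact Or.inl (Or.inr ⟨j, h1, hj, h3⟩)
      · right
        have : j = ⟨t + k, hk⟩ := Fin.ext (by show j.val = t + k; omega)
        rwa [← this]
  · rintro ((h | ⟨j, h1, h2, h3⟩) | h)
    · exact Or.inl h
    · exact Or.inr ⟨j, h1, by omega, h3⟩
    · exact Or.inr ⟨⟨t + k, hk⟩, by show t ≤ t + k; omega, by show t + k < t + (k+1); omega, h⟩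

theorem UTT_reg (htn : t ≤ n) {A : ℕ → Finset (Fin t → ℕ)} (k : ℕ) (hk : t + k < n) (m : Fin n →₀ ℕ)
    (h : Finsupp.single ⟨t + k, hk⟩ 1 + m ∈ UTT htn a A k) : m ∈ UTT htn a A k := by
  rcases h with h | ⟨j, h1, h2, h3⟩
  · left
    have : rst htn (Finsupp.single ⟨t + k, hk⟩ 1 + m) = rst htn m := by
      funext i
      have : (⟨t + k, hk⟩ : Fin n) ≠ Fin.castLE htn i := by
        intro e
        have := congrArg Fin.val e
        simp at this
        omega
      simp [rst, Finsupp.single_apply, this]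
    rwa [← this]
  · refine Or.inr ⟨j, h1, h2, ?_⟩
    have : (⟨t + k, hk⟩ : Fin n) ≠ j := by
      intro e
      have := congrArg Fin.val e
      simp at this
      omega
    simpa [Finsupp.single_apply, this] using h3

theorem UTT_ofList (htn : t ≤ n) {A : ℕ → Finset (Fin t → ℕ)} (hSh : ∀ e, Sh a e (A e) ⊆ A (e + 1))
    (k : ℕ) (hk : k ≤ n - t) :
    MI K _ (UTT_up htn hSh 0) ⊔ Ideal.ofList ((List.ofFn (vv K n t)).take k) =
      MI K _ (UTT_up htn hSh k) := by
  induction k with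
  | zero => simp
  | succ k ih =>
    rw [List.take_succ_eq_append_getElem (by simpa using hk), Ideal.ofList_append, ← sup_assoc,
      ih (by omega), Ideal.ofList_singleton, List.getElem_ofFn]
    exact MI_sup _ fun m => UTT_step htn k (by omega) m

theorem UTT_WR (htn : t ≤ n) {A : ℕ → Finset (Fin t → ℕ)} (hSh : ∀ e, Sh a e (A e) ⊆ A (e + 1)) :
    WR (MI K _ (UTT_up htn hSh 0)) (List.ofFn (vv K n t)) := by
  rw [WR_iff]
  intro i hi x
  rw [List.length_ofFn] at hi
  rw [UTT_ofList K htn hSh i hi.le, List.getElem_ofFn]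
  exact MI_reg _ (UTT_reg htn i (by omega)) x

theorem UTT_hilb (htn : t ≤ n) {A : ℕ → Finset (Fin t → ℕ)} (hSh : ∀ e, Sh a e (A e) ⊆ A (e + 1))
    (k : ℕ) (hk : k ≤ n - t) :
    hilbertFn K (MI K _ (UTT_up htn hSh 0)) = ps^[k] (hilbertFn K (MI K _ (UTT_up htn hSh k))) := by
  induction k with
  | zero => rfl
  | succ k ih =>
    rw [ih (by omega), Function.iterate_succ_apply]
    congr 1
    rw [← MI_sup (hT := UTT_up htn hSh k) (hT' := UTT_up htn hSh (k+1)) ⟨t+k, by omega⟩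
      fun m => UTT_step htn k (by omega) m]
    exact hilbertFn_ps MI_graded (isHomogeneous_X _ _) (MI_reg _ (UTT_reg htn k (by omega)))

/-- extension by zero -/
noncomputable def ext0 (n : ℕ) (w : Fin t → ℕ) : Fin n →₀ ℕ :=
  Finsupp.equivFunOnFinite.symm fun j => if h : j.val < t then w ⟨j, h⟩ else 0

theorem rst_ext0 (htn : t ≤ n) (w : Fin t → ℕ) : rst htn (ext0 n w) = w := by
  funext i
  simp [rst, ext0]

theorem ext0_rst (htn : t ≤ n) (m : Fin n →₀ ℕ) (h : ∀ j : Fin n, t ≤ j.val → m j = 0) :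
    ext0 n (rst htn m) = m := by
  ext j
  by_cases hj : j.val < t
  · simp [rst, ext0, hj]
  · simp [ext0, hj, h j (by omega)]

theorem sum_rst (htn : t ≤ n) (m : Fin n →₀ ℕ) (h : ∀ j : Fin n, t ≤ j.val → m j = 0) :
    ∑ i, rst htn m i = m.degree := by
  obtain ⟨s, rfl⟩ := Nat.exists_eq_add_of_le htn
  rw [Finsupp.degree_eq_sum, Fin.sum_univ_add, Finset.sum_eq_zero (s := Finset.univ) (f := fun i => m (Fin.natAdd t i)), add_zero]
  · rfl
  · intro i _
    exact h _ (by simp)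

theorem UTT_hilb_last (htn : t ≤ n) {A : ℕ → Finset (Fin t → ℕ)} (hSh : ∀ e, Sh a e (A e) ⊆ A (e + 1))
    (hA : ∀ e, A e ⊆ Bx a e) (d : ℕ) :
    hilbertFn K (MI K _ (UTT_up htn hSh (n - t))) d = (Bx a d \ A d).card := by
  classical
  have hz : ∀ w : Fin t → ℕ, ∀ j : Fin n, t ≤ j.val → ext0 n w j = 0 := by
    intro w j hj
    simp [ext0, Nat.not_lt.2 hj]
  have hdeg : ∀ w : Fin t → ℕ, (ext0 n w).degree = ∑ i, w i := by
    intro w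
    rw [← sum_rst htn _ (hz w), rst_ext0]
  let φ : homogeneousSubmodule (Fin n) K d →ₗ[K] ((Bx a d \ A d : Finset (Fin t → ℕ)) → K) :=
    LinearMap.pi fun w => (lcoeff K (ext0 n w.1)).comp (homogeneousSubmodule (Fin n) K d).subtype
  have hφ : ∀ F w, φ F w = coeff (ext0 n w.1) (F : MvPolynomial (Fin n) K) := fun F w => rfl
  have hsurj : Function.Surjective φ := by
    intro c
    have hh : (∑ w, monomial (ext0 n w.1) (c w)) ∈ homogeneousSubmodule (Fin n) K d := by
      refine sum_mem fun w _ => ?_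
      apply isHomogeneous_monomial
      rw [hdeg]
      exact (mem_Bx.1 (Finset.mem_sdiff.1 w.2).1).2
    refine ⟨⟨_, hh⟩, ?_⟩
    funext w
    rw [hφ]
    show coeff _ (∑ w, monomial (ext0 n w.1) (c w)) = _
    rw [coeff_sum]
    simp only [coeff_monomial]
    rw [Finset.sum_eq_single w]
    · simp
    · intro w' _ hne
      rw [if_neg]
      intro e
      apply hne
      apply Subtype.ext
      rw [← rst_ext0 htn w'.1, e, rst_ext0]
    · simp
  have := finrank_quot_of_ker φ hsurj (Submodule.comap (homogeneousSubmodule (Fin n) K d).subtype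
        (Submodule.restrictScalars K (MI K _ (UTT_up htn hSh (n - t))))) (by
    intro F
    show _ ↔ (F : MvPolynomial (Fin n) K) ∈ MI K _ (UTT_up htn hSh (n - t))
    constructor
    · intro h m hm
      by_contra hcon
      have h0 : ∀ j : Fin n, t ≤ j.val → m j = 0 := by
        intro j hj
        by_contra hne
        exact hcon (Or.inr ⟨j, hj, by omega, hne⟩)
      have hE : ¬ Ex a A (rst htn m) := fun h => hcon (Or.inl h)
      have hd : m.degree = d := by
        rw [Finsupp.degree_eq_weight_one]
        exact F.2 hm
      rw [Ex, sum_rst htn m h0, hd, Classical.not_imp] at hE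
      have := congrFun h ⟨rst htn m, Finset.mem_sdiff.2 hE⟩
      rw [hφ, ext0_rst htn m h0] at this
      exact hm this
    · intro h
      funext w
      rw [hφ]
      by_contra hne
      have hw := Finset.mem_sdiff.1 w.2
      have hs := (mem_Bx.1 hw.1).2
      rcases h _ hne with h1 | ⟨j, h1, h2, h3⟩
      · rw [rst_ext0, Ex, hs] at h1
        exact hw.2 (h1 hw.1)
      · exact h3 (hz _ j h1))
  rw [hilbertFn, this]
  simp

end Con
end EGH

namespace EGH
open Finset

theorem ps_iter_zero (k : ℕ) (h : ℕ → ℕ) : ps^[k] h 0 = h 0 := by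
  induction k generalizing h with
  | zero => rfl
  | succ k ih =>
    rw [Function.iterate_succ_apply, ih]
    simp [ps]

theorem hilb_zero_ne {n : ℕ} (K : Type*) [Field K] (I : Ideal (MvPolynomial (Fin n) K))
    (hI : I ≠ ⊤) : hilbertFn K I 0 ≠ 0 := by
  intro h0
  rw [hilbertFn] at h0
  have hsub := Module.finrank_zero_iff.1 h0
  rw [Submodule.Quotient.subsingleton_iff] at hsub
  apply hI
  rw [Ideal.eq_top_iff_one]
  have : (⟨1, isHomogeneous_one _ _⟩ : homogeneousSubmodule (Fin n) K 0) ∈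
    (Submodule.comap (homogeneousSubmodule (Fin n) K 0).subtype
        (Submodule.restrictScalars K I)) := by rw [hsub]; trivial
  exact this

theorem dim_le {n t : ℕ} (htn : t ≤ n) (K : Type*) [Field K] (a : Fin t → ℕ)
    (J : Ideal (MvPolynomial (Fin n) K))
    (hJ : ∀ i : Fin t, (X (Fin.castLE htn i) : MvPolynomial (Fin n) K) ^ a i ∈ J) :
    ringKrullDim (MvPolynomial (Fin n) K ⧸ J) ≤ ((n - t : ℕ) : WithBot ℕ∞) := by
  obtain ⟨W, hWdef⟩ : ∃ W : Submodule K (MvPolynomial (Fin n) K),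
    W = Submodule.span K (Set.range fun i : Fin t => (X (Fin.castLE htn i) : MvPolynomial (Fin n) K)) :=
    ⟨_, rfl⟩
  have hW : W ≤ homogeneousSubmodule (Fin n) K 1 := by
    rw [hWdef, Submodule.span_le]
    rintro _ ⟨i, rfl⟩
    exact isHomogeneous_X _ _
  have hp := lin_prime hW
  have hXW : ∀ i : Fin t, (X (Fin.castLE htn i) : MvPolynomial (Fin n) K) ∈ W := by
    intro i; rw [hWdef]; exact Submodule.subset_span ⟨i, rfl⟩
  have hh := le_lin_height_aux (fun i : Fin t => (X (Fin.castLE htn i) : MvPolynomial (Fin n) K))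
    ((MvPolynomial.linearIndependent_X (Fin n) K).comp _ (Fin.castLE_injective htn)) W hW hXW
  obtain ⟨x, hx⟩ : ∃ x : PrimeSpectrum (MvPolynomial (Fin n) K),
    x.asIdeal = Ideal.span (W : Set (MvPolynomial (Fin n) K)) := ⟨⟨_, hp⟩, rfl⟩
  rw [← hx, PrimeSpectrum.height_eq_orderHeight] at hh
  have hle : ∀ y : PrimeSpectrum.zeroLocus (J : Set (MvPolynomial (Fin n) K)), x ≤ y.1 := by
    intro y
    show x.asIdeal ≤ y.1.asIdeal
    rw [hx, Ideal.span_le]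
    have : W ≤ Submodule.restrictScalars K y.1.asIdeal := by
      rw [hWdef, Submodule.span_le]
      rintro _ ⟨i, rfl⟩
      exact y.1.isPrime.mem_of_pow_mem _ (y.2 (hJ i))
    exact this
  rw [ringKrullDim_quotient]
  have h1 : Order.krullDim (PrimeSpectrum.zeroLocus (J : Set (MvPolynomial (Fin n) K))) ≤
      Order.krullDim (Set.Ici x) :=
    Order.krullDim_le_of_strictMono (fun y => ⟨y.1, hle y⟩) (fun y z h => h)
  rw [← Order.coheight_eq_krullDim_Ici] at h1
  refine h1.trans ?_
  have h2 : ringKrullDim (MvPolynomial (Fin n) K) = n := by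
    rw [MvPolynomial.ringKrullDim_of_isNoetherianRing, ringKrullDim_eq_zero_of_field]
    simp
  rw [ringKrullDim, Order.krullDim_eq_iSup_height_add_coheight_of_nonempty] at h2
  have h2' : (⨆ y : PrimeSpectrum (MvPolynomial (Fin n) K), Order.height y + Order.coheight y) = (n : ℕ∞) := by
    exact_mod_cast h2
  have h3 : Order.height x + Order.coheight x ≤ (n : ℕ∞) := by
    rw [← h2']
    exact le_iSup (fun y => Order.height y + Order.coheight y) x
  have h4 : (t : ℕ∞) + Order.coheight x ≤ n := (add_le_add_left hh _).trans h3
  have h5 : Order.coheight x ≤ ((n - t : ℕ) : ℕ∞) := by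
    generalize Order.coheight x = c at h4
    cases c with
    | top => simp at h4
    | coe c =>
      norm_cast at h4 ⊢
      omega
  exact WithBot.coe_le_coe.2 h5

theorem final {n t : ℕ} (htn : t ≤ n) (K : Type*) [Field K] (a : Fin t → ℕ) (h : ℕ → ℕ)
    (hM : Mac a h) (h0 : h 0 ≠ 0) :
    ∃ J : Ideal (MvPolynomial (Fin n) K), IsGradedIdeal J ∧
      (∀ i : Fin t, (X (Fin.castLE htn i) : MvPolynomial (Fin n) K) ^ a i ∈ J) ∧
      QuotientIsCM J ∧
      hilbertFn K J = ps^[n - t] h := by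
  classical
  obtain ⟨A, hseg, hcard, hSh⟩ := hM.family
  have hA : ∀ e, A e ⊆ Bx a e := fun e => (hseg e).1
  have hc : ∀ d, (Bx a d \ A d).card = h d := by
    intro d
    have h1 := Finset.card_sdiff_add_card_eq_card (hA d)
    have h2 := hcard d
    omega
  have hlast : hilbertFn K (MI K _ (UTT_up htn hSh (n - t))) = h := by
    funext d
    rw [UTT_hilb_last K htn hSh hA, hc]
  have hne : MI K _ (UTT_up htn hSh (n - t)) ≠ ⊤ := by
    intro e
    have h1 : (1 : MvPolynomial (Fin n) K) ∈ MI K _ (UTT_up htn hSh (n - t)) := by rw [e]; trivial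
    have h2 := h1 0 (by simp)
    rcases h2 with h2 | ⟨j, _, _, h3⟩
    · have hpos : 0 < (Bx a 0 \ A 0).card := by rw [hc]; omega
      obtain ⟨w, hw⟩ := Finset.card_pos.1 hpos
      rw [Finset.mem_sdiff] at hw
      have hw1 := (mem_Bx.1 hw.1).2
      have hw0 : w = rst htn 0 := by
        funext i
        have := (Finset.sum_eq_zero_iff.1 hw1) i (Finset.mem_univ i)
        rw [this]; rfl
      rw [← hw0, Ex, hw1] at h2
      exact hw.2 (h2 hw.1)
    · exact h3 rfl
  have hofl := UTT_ofList K htn hSh (n - t) le_rfl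
  rw [List.take_of_length_le (by simp)] at hofl
  have hWR := UTT_WR K htn hSh
  have hH := UTT_hilb K htn hSh (n - t) le_rfl
  rw [hlast] at hH
  have hX : ∀ i : Fin t, (X (Fin.castLE htn i) : MvPolynomial (Fin n) K) ^ a i ∈
      MI K _ (UTT_up htn hSh 0) := by
    intro i
    rw [X_pow_eq_monomial]
    apply monomial_mem_MI
    left
    intro hB
    have := (mem_Bx.1 hB).1 i
    simp [rst] at this
  have hG : IsGradedIdeal (MI K _ (UTT_up htn hSh 0)) := MI_graded
  generalize MI K _ (UTT_up htn hSh 0) = J at *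
  refine ⟨J, hG, hX, ?_, hH⟩
  have hWR' : WR (⊥ : Ideal (MvPolynomial (Fin n) K ⧸ J))
      ((List.ofFn (vv K n t)).map (Ideal.Quotient.mk J)) := by
    rw [WR_map _ Ideal.Quotient.mk_surjective, ← RingHom.ker_eq_comap_bot, Ideal.mk_ker]
    exact hWR
  have hnt : Ideal.ofList ((List.ofFn (vv K n t)).map (Ideal.Quotient.mk J)) ≠ ⊤ := by
    intro e
    rw [← Ideal.map_ofList] at e
    apply hne
    rw [← hofl, sup_comm]
    have := congrArg (Ideal.comap (Ideal.Quotient.mk J)) e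
    rw [Ideal.comap_map_of_surjective _ Ideal.Quotient.mk_surjective, ← RingHom.ker_eq_comap_bot,
      Ideal.mk_ker, Ideal.comap_top] at this
    exact this
  refine ⟨(List.ofFn (vv K n t)).map (Ideal.Quotient.mk J), ?_, ?_, ?_⟩
  · intro y hy
    obtain ⟨z, hz, rfl⟩ := List.mem_map.1 hy
    obtain ⟨i, rfl⟩ := (List.mem_ofFn' _ _).1 hz
    exact Ideal.mem_map_of_mem _ (Ideal.subset_span ⟨_, rfl⟩)
  · refine ⟨(isWeaklyRegular_iff_WR _).2 hWR', ?_⟩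
    rw [smul_eq_mul, Ideal.mul_top]
    exact hnt.symm
  · apply le_antisymm
    · obtain ⟨P, hP, hle⟩ := Ideal.exists_le_maximal _ hnt
      have := hP.isPrime
      obtain ⟨P0, _, _, _, h3⟩ := WR_height _ ⊥ hWR' P (by rwa [bot_sup_eq])
      have h4 : ((((List.ofFn (vv K n t)).map (Ideal.Quotient.mk J)).length : ℕ) : ℕ∞) ≤ P.height :=
        le_add_self.trans h3
      have h5 := Ideal.height_le_ringKrullDim_of_isPrime (I := P)
      refine le_trans ?_ h5
      exact_mod_cast h4
    · have := dim_le htn K a J hX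
      simpa using this

end EGH

/-- **Theorem 24 of the paper.**  Let `M` be a totally reducible ideal containing a
homogeneous regular sequence of degrees `a₁ ≤ ⋯ ≤ a_t`.  If `I ⊇ M` is a Cohen–Macaulay
graded ideal of height `t`, then `I` has the same Hilbert function as a Cohen–Macaulay
graded ideal containing `x₁^{a₁},…,x_t^{a_t}`. -/
theorem egh_preserving_cohen_macaulayness
    {n t : ℕ} (htn : t ≤ n) (K : Type*) [Field K]
    (M : Ideal (MvPolynomial (Fin n) K)) (hred : TotallyReducible M)
    (a : Fin t → ℕ) (ha : Monotone a)
    (f : Fin t → MvPolynomial (Fin n) K)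
    (hfM : ∀ i, f i ∈ M)
    (hfhom : ∀ i, (f i).IsHomogeneous (a i))
    (hfreg : RingTheory.Sequence.IsRegular (MvPolynomial (Fin n) K) (List.ofFn f))
    (I : Ideal (MvPolynomial (Fin n) K)) (hIgr : IsGradedIdeal I) (hMI : M ≤ I)
    (hht : idealHeight I = t) (hCM : QuotientIsCM I) :
    ∃ J : Ideal (MvPolynomial (Fin n) K), IsGradedIdeal J ∧
      (∀ i : Fin t, (X (Fin.castLE htn i) : MvPolynomial (Fin n) K) ^ a i ∈ J) ∧
      QuotientIsCM J ∧
      ∀ d : ℕ, hilbertFn K J d = hilbertFn K I d := by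
  obtain ⟨hI, h, hMac, hH⟩ := EGH.main_mac htn K M hred a ha f hfM hfhom hfreg I hIgr hMI hht hCM
  have h0 : h 0 ≠ 0 := by
    have := EGH.hilb_zero_ne K I hI
    rwa [hH, EGH.ps_iter_zero] at this
  obtain ⟨J, h1, h2, h3, h4⟩ := EGH.final htn K a h hMac h0
  exact ⟨J, h1, h2, h3, fun d => by rw [h4, hH]⟩
end

section
/- Let S = K[x_1,...,x_n] over a field K and let S̄ = K[x_2,...,x_n]. Fix integers r ≥ 1 and d ≥ 0. Let K_r = { z x_1^{r+j} : z a monomial of S̄, j ≥ 0 }, and for 0 ≤ i ≤ r−1 let L_i be a monomial ideal of S̄ such that L_{i,d−i} ⊆ L_{i+1,d−i} for all 0 ≤ i ≤ r−2 (where L_{i,j} denotes the degree-j component), and set K_i = { z x_1^i : z a monomial of L_i with d−i ≤ deg(z) ≤ d−i+1 }. Let L be the ideal of S generated by the union of the sets K_0,...,K_{r−1},K_r. Then every monomial of L of degree d or d+1 lies in K_0 ∪ ... ∪ K_{r−1} ∪ K_r. -/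
set_option synthInstance.maxHeartbeats 1000000
set_option maxHeartbeats 1000000

open MvPolynomial

/-- The total degree of a monomial given by its exponent vector. -/
def mdeg {n : ℕ} (s : Fin n →₀ ℕ) : ℕ := s.sum fun _ e => e

/-- **The second claim in the proof of Theorem 21 of the paper.**
Let `S = K[x₁,…,xₙ]` and `S̄ = K[x₂,…,xₙ]` (monomials of `S̄` are represented by the
exponent vectors vanishing at the first variable `x₁`).  Fix `r ≥ 1` and `d ≥ 0`.  Let
`M i` (for `i < r`) be the monomial sets of monomial ideals `L_i` of `S̄` with
`L_{i,d-i} ⊆ L_{i+1,d-i}`, let `Kr = {z·x₁^{r+j} : z ∈ Mon(S̄), j ≥ 0}` and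
`Kᵢ = {z·x₁^i : z ∈ Mon(L_i), d-i ≤ deg z ≤ d-i+1}`, and let `L` be the ideal of `S`
generated by `K₀ ∪ ⋯ ∪ K_{r-1} ∪ Kr`.  Then every monomial of `L` of degree `d` or `d+1`
lies in `K₀ ∪ ⋯ ∪ K_{r-1} ∪ Kr`. -/
theorem monomials_of_degree_d_or_succ_lie_in_generating_layers
    {n : ℕ} (hn : 0 < n) (K : Type*) [Field K]
    (r d : ℕ) (hr : 1 ≤ r)
    (M : Fin r → Set (Fin n →₀ ℕ))
    -- each `M i` consists of monomials of `S̄ = K[x₂,…,xₙ]`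
    (hM0 : ∀ i : Fin r, ∀ s ∈ M i, s ⟨0, hn⟩ = 0)
    -- each `M i` is (the monomial set of) a monomial ideal of `S̄`
    (hMideal : ∀ i : Fin r, ∀ s ∈ M i, ∀ s' : Fin n →₀ ℕ, s' ⟨0, hn⟩ = 0 → s + s' ∈ M i)
    -- the nesting hypothesis `L_{i,d-i} ⊆ L_{i+1,d-i}` for `0 ≤ i ≤ r-2`
    (hnest : ∀ i : Fin r, ∀ h : (i : ℕ) + 1 < r, ∀ s ∈ M i,
      ((mdeg s : ℤ) = (d : ℤ) - (i : ℕ)) → s ∈ M ⟨(i : ℕ) + 1, h⟩)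
    (Kr : Set (Fin n →₀ ℕ)) (hKr : Kr = {s | r ≤ s ⟨0, hn⟩})
    (Ki : Fin r → Set (Fin n →₀ ℕ))
    (hKi : ∀ i : Fin r, Ki i = {u | ∃ s ∈ M i,
      ((d : ℤ) - (i : ℕ) ≤ (mdeg s : ℤ)) ∧ ((mdeg s : ℤ) ≤ (d : ℤ) - (i : ℕ) + 1) ∧
      u = s + Finsupp.single ⟨0, hn⟩ (i : ℕ)})
    (L : Ideal (MvPolynomial (Fin n) K))
    (hL : L = Ideal.span
      ((fun s => (monomial s (1 : K))) '' (Kr ∪ ⋃ i : Fin r, Ki i))) :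
    ∀ w : Fin n →₀ ℕ, monomial w (1 : K) ∈ L → (mdeg w = d ∨ mdeg w = d + 1) →
      w ∈ Kr ∪ ⋃ i : Fin r, Ki i := by
  intro w hw hdeg
  have hadd : ∀ a b : Fin n →₀ ℕ, mdeg (a + b) = mdeg a + mdeg b := by
    intro a b
    exact Finsupp.sum_add_index' (fun _ => rfl) (fun _ _ _ => rfl)
  have hsingle : ∀ k : ℕ, mdeg (Finsupp.single (⟨0, hn⟩ : Fin n) k) = k := by
    intro k
    exact Finsupp.sum_single_index rfl
  rw [hL, mem_ideal_span_monomial_image] at hw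
  obtain ⟨u, hu, huw⟩ := hw w (by classical simp [support_monomial])
  by_cases hwr : r ≤ w ⟨0, hn⟩
  · left; rw [hKr]; exact hwr
  right
  rcases hu with hu | hu
  · rw [hKr] at hu
    exact absurd (le_trans hu (huw _)) hwr
  obtain ⟨i, hi⟩ := Set.mem_iUnion.1 hu
  rw [hKi] at hi
  obtain ⟨s, hs, h1, h2, rfl⟩ := hi
  obtain ⟨t, rfl⟩ := exists_add_of_le huw
  have hs0 := hM0 i s hs
  simp only [hadd, hsingle] at hdeg
  simp only [Finsupp.add_apply, Finsupp.single_eq_same, hs0] at hwr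
  have ht : t = t.erase ⟨0, hn⟩ + Finsupp.single ⟨0, hn⟩ (t ⟨0, hn⟩) :=
    (Finsupp.erase_add_single _ _).symm
  have htd := congrArg mdeg ht
  rw [hadd, hsingle] at htd
  have he0 : (t.erase ⟨0, hn⟩) ⟨0, hn⟩ = 0 := Finsupp.erase_same
  generalize t.erase ⟨0, hn⟩ = t' at *
  generalize t ⟨0, hn⟩ = k at *
  subst ht
  rw [Set.mem_iUnion]
  rcases Nat.eq_zero_or_pos k with hk | hk
  · refine ⟨i, ?_⟩
    rw [hKi]
    refine ⟨s + t', hMideal i s hs t' he0, ?_, ?_, ?_⟩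
    · rw [hadd]; omega
    · rw [hadd]; omega
    · subst hk; simp; abel
  · have hk1 : k = 1 := by omega
    subst hk1
    have ht0 : mdeg t' = 0 := by omega
    have ht' : t' = 0 := by
      ext j
      by_contra hj
      have hj' : j ∈ t'.support := Finsupp.mem_support_iff.2 hj
      have := Finset.single_le_sum (f := fun j => t' j) (fun _ _ => Nat.zero_le _) hj'
      change t' j ≤ mdeg t' at this
      simp at hj
      omega
    subst ht'
    have hlt : (i : ℕ) + 1 < r := by omega
    refine ⟨⟨(i : ℕ) + 1, hlt⟩, ?_⟩
    rw [hKi]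
    refine ⟨s, hnest i hlt s hs (by omega), ?_, ?_, ?_⟩
    · push_cast; omega
    · push_cast; omega
    · rw [zero_add, add_assoc, ← Finsupp.single_add]
end
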